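/- In the logistic regression model, assume Θ satisfies Condition 1 and that Conditions L1 and L2 hold. Let θ̂_n ∈ argmin_{θ∈Θ} M_n(θ) be measurable, C̄_{n,0} = Cov(√n ∇M_n(θ₀)) and H̄_{n,0} = E[∇²M_n(θ₀)]. Then there exist constants 0 < C₁ < ∞, 0 < C₂ < ∞ and N ∈ ℕ such that for n ≥ N, with Z a standard Gaussian vector on ℝ^p, W₁(C̄_{n,0}^{−1/2} H̄_{n,0} √n (θ̂_n − θ₀), Z) ≤ C₁ (log n)^{C₂} / √n. -/

import Mathlib

open MeasureTheory ProbabilityTheory Set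

noncomputable section

/-- `ℝ^p` with the Euclidean norm. -/
abbrev Euc (p : ℕ) := EuclideanSpace ℝ (Fin p)

/-- Build a Euclidean vector from a plain function. -/
def toEuc {p : ℕ} (v : Fin p → ℝ) : Euc p := (WithLp.equiv 2 (Fin p → ℝ)).symm v

/-- The standard Gaussian distribution on `ℝ^p`. -/
def stdGaussian (p : ℕ) : Measure (Euc p) :=
  (Measure.pi fun _ : Fin p => gaussianReal 0 1).map (toEuc (p := p))

/-- The `L¹` Wasserstein distance between two distributions on `ℝ^p`
(dual formulation: supremum over `1`-Lipschitz test functions). -/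
def W1 {p : ℕ} (P Q : Measure (Euc p)) : ℝ :=
  sSup { r | ∃ f : Euc p → ℝ, LipschitzWith 1 f ∧
    r = |(∫ x, f x ∂P) - (∫ x, f x ∂Q)| }

/-- Partial derivative in the `i`-th coordinate direction. -/
def pder {p : ℕ} (i : Fin p) (f : Euc p → ℝ) (θ : Euc p) : ℝ :=
  fderiv ℝ f θ (EuclideanSpace.single i 1)

/-- The gradient as a Euclidean vector. -/
def gradVec {p : ℕ} (f : Euc p → ℝ) (θ : Euc p) : Euc p := toEuc fun i => pder i f θ

section

open scoped NNReal RealInnerProductSpace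

variable {p : ℕ}

/-- Bounded continuous functions are integrable for finite measures. -/
lemma integrable_of_continuous_of_bounded {E : Type*} [TopologicalSpace E] [MeasurableSpace E]
    [OpensMeasurableSpace E] {P : Measure E} [IsFiniteMeasure P] {g : E → ℝ} (hg : Continuous g)
    {B : ℝ} (hB : ∀ x, |g x| ≤ B) : Integrable g P :=
  Integrable.of_bound hg.measurable.aestronglyMeasurable B (ae_of_all _ hB)

lemma integral_gaussianReal_shift (g : ℝ → ℝ) (v : ℝ≥0) (s : ℝ) :
    ∫ w, g (s + w) ∂(gaussianReal 0 v) = ∫ w, g w ∂(gaussianReal s v) := by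
  have h := gaussianReal_map_const_add (μ := 0) (v := v) s
  rw [zero_add] at h
  rw [← h, MeasurableEmbedding.integral_map (measurableEmbedding_addLeft s)]

lemma hasDerivAt_gaussianReal_zero {g : ℝ → ℝ} (hg : Continuous g) {B : ℝ}
    (hB : ∀ x, |g x| ≤ B) {v : ℝ≥0} (hv : v ≠ 0) :
    HasDerivAt (fun s => ∫ w, g (s + w) ∂(gaussianReal 0 v))
      (∫ w, g w * (w / v) ∂(gaussianReal 0 v)) 0 := by
  have hv0 : (0 : ℝ) < v := by positivity
  have e1 : (fun s => ∫ w, g (s + w) ∂(gaussianReal 0 v))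
      = fun s => ∫ w, gaussianPDFReal s v w * g w := by
    funext s
    rw [integral_gaussianReal_shift, integral_gaussianReal_eq_integral_smul hv]
    simp
  rw [e1, integral_gaussianReal_eq_integral_smul hv]
  have hB0 : 0 ≤ B := (abs_nonneg _).trans (hB 0)
  set K : ℝ := (√(2 * Real.pi * v))⁻¹ with hK
  have hK0 : 0 ≤ K := by positivity
  have key := hasDerivAt_integral_of_dominated_loc_of_deriv_le (𝕜 := ℝ) (E := ℝ) (μ := volume)
    (F := fun s w => gaussianPDFReal s v w * g w)
    (F' := fun s w => gaussianPDFReal s v w * ((w - s) / v) * g w)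
    (x₀ := 0) (s := Metric.ball 0 1)
    (bound := fun w => B * K * Real.exp (1 / (2 * v)) / v *
      (|w * Real.exp (-(1 / (4 * v)) * w ^ 2)| + Real.exp (-(1 / (4 * v)) * w ^ 2)))
    (Metric.ball_mem_nhds _ one_pos) ?_ ?_ ?_ ?_ ?_ ?_
  · refine key.2.congr_deriv ?_
    refine integral_congr_ae (ae_of_all _ fun w => ?_)
    simp only [smul_eq_mul]
    ring
  · refine Filter.Eventually.of_forall fun s => ?_
    exact ((measurable_gaussianPDFReal s v).mul hg.measurable).aestronglyMeasurable
  · exact (integrable_gaussianPDFReal 0 v).mul_bdd (c := B) hg.measurable.aestronglyMeasurable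
      (ae_of_all _ hB)
  · exact (((measurable_gaussianPDFReal 0 v).mul (by fun_prop)).mul
      hg.measurable).aestronglyMeasurable
  · refine ae_of_all _ fun w s hs => ?_
    have hs1 : |s| ≤ 1 := by simpa using (Metric.mem_ball.1 hs).le
    have hexp : Real.exp (-(w - s) ^ 2 / (2 * v))
        ≤ Real.exp (1 / (2 * v)) * Real.exp (-(1 / (4 * v)) * w ^ 2) := by
      rw [← Real.exp_add]
      apply Real.exp_le_exp.2
      have : 1 / (2 * (v : ℝ)) + -(1 / (4 * v)) * w ^ 2 - -(w - s) ^ 2 / (2 * v)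
          = ((w - 2 * s) ^ 2 + 2 * (1 - s ^ 2)) / (4 * v) := by
        field_simp
        ring
      have h2 : s ^ 2 ≤ 1 := by rw [sq_le_one_iff_abs_le_one]; exact hs1
      have : 0 ≤ ((w - 2 * s) ^ 2 + 2 * (1 - s ^ 2)) / (4 * (v : ℝ)) := by
        apply div_nonneg _ (by positivity)
        nlinarith [sq_nonneg (w - 2 * s)]
      linarith
    have h3 : |w - s| ≤ |w| + 1 := (abs_sub _ _).trans (by linarith)
    rw [gaussianPDFReal_def, ← hK, Real.norm_eq_abs, abs_mul, abs_mul, abs_mul, abs_div,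
      abs_of_nonneg hK0, abs_of_pos (Real.exp_pos _), abs_of_pos hv0, abs_mul w,
      abs_of_pos (Real.exp_pos (-(1 / (4 * (v : ℝ))) * w ^ 2))]
    calc K * Real.exp (-(w - s) ^ 2 / (2 * v)) * (|w - s| / v) * |g w|
        ≤ K * (Real.exp (1 / (2 * v)) * Real.exp (-(1 / (4 * v)) * w ^ 2))
          * ((|w| + 1) / v) * B := by
          gcongr
          exact hB w
      _ = _ := by ring
  · refine Integrable.const_mul (Integrable.add ?_ ?_) _
    · exact (integrable_mul_exp_neg_mul_sq (by positivity)).abs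
    · exact integrable_exp_neg_mul_sq (by positivity)
  · refine ae_of_all _ fun w s _ => ?_
    have h1 : HasDerivAt (fun s : ℝ => gaussianPDFReal s v w)
        (gaussianPDFReal s v w * ((w - s) / v)) s := by
      simp only [gaussianPDFReal_def, ← hK]
      have h2 : HasDerivAt (fun s : ℝ => -(w - s) ^ 2 / (2 * v)) ((w - s) / v) s := by
        refine (((((hasDerivAt_id s).const_sub w).fun_pow 2).fun_neg).div_const
          (2 * (v : ℝ))).congr_deriv ?_
        simp
        field_simp
      refine ((h2.exp).const_mul K).congr_deriv ?_
      ring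
    exact h1.mul_const _

/-- Gaussian smoothing of a function on `ℝ`. -/
def gaussSmooth (v : ℝ≥0) (g : ℝ → ℝ) (s : ℝ) : ℝ := ∫ w, g (s + w) ∂(gaussianReal 0 v)

/-- Derivative of the Gaussian smoothing of a function on `ℝ`. -/
def gaussSmoothDeriv (v : ℝ≥0) (g : ℝ → ℝ) (s : ℝ) : ℝ :=
  ∫ w, g (s + w) * (w / v) ∂(gaussianReal 0 v)

lemma hasDerivAt_gaussSmooth {g : ℝ → ℝ} (hg : Continuous g) {B : ℝ}
    (hB : ∀ x, |g x| ≤ B) {v : ℝ≥0} (hv : v ≠ 0) (s : ℝ) :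
    HasDerivAt (gaussSmooth v g) (gaussSmoothDeriv v g s) s := by
  have h := hasDerivAt_gaussianReal_zero (g := fun w => g (s + w))
    (hg.comp (continuous_const.add continuous_id)) (fun _ => hB _) hv
  have h2 : HasDerivAt (fun r : ℝ => r - s) 1 s := (hasDerivAt_id s).sub_const s
  have h3 := HasDerivAt.comp (h₂ := fun s' => ∫ w, g (s + (s' + w)) ∂(gaussianReal 0 v)) s
    (by simpa using h) h2
  refine (h3.congr_deriv (mul_one _)).congr_of_eventuallyEq (Filter.Eventually.of_forall fun r => ?_)
  simp [gaussSmooth, ← add_assoc]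

lemma integral_abs_gaussianReal_le (v : ℝ≥0) :
    ∫ w, |w| ∂(gaussianReal 0 v) ≤ √v := by
  have h2 : ∫ w, w ^ 2 ∂(gaussianReal 0 v) = v := by
    have := variance_fun_id_gaussianReal (μ := 0) (v := v)
    rw [variance_eq_integral (by fun_prop)] at this
    simpa using this
  have hm : MemLp (fun w : ℝ => |w|) 2 (gaussianReal 0 v) :=
    (memLp_id_gaussianReal' 2 (by simp)).abs
  have hvar := variance_nonneg (fun w : ℝ => |w|) (gaussianReal 0 v)
  rw [variance_eq_sub hm] at hvar
  simp only [Pi.pow_apply, sq_abs, h2] at hvar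
  exact Real.le_sqrt_of_sq_le (by linarith)

lemma integrable_pow_abs_gaussianReal (v : ℝ≥0) (k : ℕ) :
    Integrable (fun w : ℝ => |w| ^ k) (gaussianReal 0 v) := by
  have := (memLp_id_gaussianReal' (μ := 0) (v := v) k (by simp)).integrable_norm_pow'
  simpa using this

lemma integrable_bdd_mul_gaussianReal {g : ℝ → ℝ} (hg : Continuous g) {B : ℝ}
    (hB : ∀ x, |g x| ≤ B) (v : ℝ≥0) (s : ℝ) :
    Integrable (fun w => g (s + w) * (w / v)) (gaussianReal 0 v) := by
  refine Integrable.bdd_mul (c := B) ?_ ?_ (ae_of_all _ fun w => hB _)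
  · exact ((memLp_id_gaussianReal' 1 (by simp)).integrable le_rfl).div_const _
  · exact (hg.comp (continuous_const.add continuous_id)).measurable.aestronglyMeasurable

lemma gaussSmoothDeriv_lipschitz {g : ℝ → ℝ} {K B : ℝ} (hK : 0 ≤ K)
    (hL : ∀ x y, |g x - g y| ≤ K * |x - y|) (hg : Continuous g)
    (hB : ∀ x, |g x| ≤ B) {v : ℝ≥0} (hv : v ≠ 0) (x y : ℝ) :
    |gaussSmoothDeriv v g x - gaussSmoothDeriv v g y| ≤ K / √v * |x - y| := by
  have hv0 : (0 : ℝ) < v := by positivity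
  have hs : (v : ℝ) = √v * √v := (Real.mul_self_sqrt hv0.le).symm
  have hs0 : 0 < √(v : ℝ) := Real.sqrt_pos.2 hv0
  unfold gaussSmoothDeriv
  rw [← integral_sub (integrable_bdd_mul_gaussianReal hg hB v x)
    (integrable_bdd_mul_gaussianReal hg hB v y)]
  have h1 := integrable_pow_abs_gaussianReal v 1
  simp only [pow_one] at h1
  calc |∫ w, (g (x + w) * (w / v) - g (y + w) * (w / v)) ∂(gaussianReal 0 v)|
      ≤ ∫ w, K * |x - y| / v * |w| ∂(gaussianReal 0 v) := by
        rw [← Real.norm_eq_abs]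
        refine norm_integral_le_of_norm_le (h1.const_mul _) (ae_of_all _ fun w => ?_)
        rw [← sub_mul, Real.norm_eq_abs, abs_mul, abs_div, abs_of_pos hv0]
        have := hL (x + w) (y + w)
        rw [add_sub_add_right_eq_sub] at this
        calc |g (x + w) - g (y + w)| * (|w| / v) ≤ K * |x - y| * (|w| / v) := by gcongr
          _ = _ := by ring
    _ ≤ K * |x - y| / v * √v := by
        rw [integral_const_mul]
        gcongr
        exact integral_abs_gaussianReal_le v
    _ = K / √v * |x - y| := by
        rw [div_mul_eq_mul_div, div_mul_eq_mul_div, div_eq_div_iff hv0.ne' hs0.ne']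
        nth_rewrite 3 [hs]
        ring

lemma gaussSmoothDeriv_bounded {g : ℝ → ℝ} {B : ℝ}
    (hB : ∀ x, |g x| ≤ B) (v : ℝ≥0) :
    ∃ B', ∀ x, |gaussSmoothDeriv v g x| ≤ B' := by
  have h1 := integrable_pow_abs_gaussianReal v 1
  simp only [pow_one] at h1
  refine ⟨∫ w, B / v * |w| ∂(gaussianReal 0 v), fun x => ?_⟩
  unfold gaussSmoothDeriv
  rw [← Real.norm_eq_abs]
  refine norm_integral_le_of_norm_le (h1.const_mul _) (ae_of_all _ fun w => ?_)
  rw [Real.norm_eq_abs, abs_mul, abs_div, abs_of_nonneg v.coe_nonneg]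
  calc |g (x + w)| * (|w| / v) ≤ B * (|w| / v) := by gcongr; exact hB _
    _ = _ := by ring

lemma gaussSmooth_bounded {g : ℝ → ℝ} {B : ℝ} (hB : ∀ x, |g x| ≤ B) (v : ℝ≥0) (x : ℝ) :
    |gaussSmooth v g x| ≤ B := by
  unfold gaussSmooth
  have := norm_integral_le_of_norm_le_const (μ := gaussianReal 0 v)
    (f := fun w => g (x + w)) (C := B) (ae_of_all _ fun w => hB _)
  simpa using this

/-- Two successive Gaussian smoothings of a bounded Lipschitz function produce a `C²` function
with Lipschitz second derivative. -/
lemma exists_derivs_gaussSmooth_gaussSmooth {g : ℝ → ℝ} {K B : ℝ} (hK : 0 ≤ K)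
    (hL : ∀ x y, |g x - g y| ≤ K * |x - y|) (hg : Continuous g)
    (hB : ∀ x, |g x| ≤ B) {v : ℝ≥0} (hv : v ≠ 0) :
    ∃ G' G'' : ℝ → ℝ, (∀ s, HasDerivAt (gaussSmooth v (gaussSmooth v g)) (G' s) s) ∧
      (∀ s, HasDerivAt G' (G'' s) s) ∧ ∀ x y, |G'' x - G'' y| ≤ K / v * |x - y| := by
  have hd := hasDerivAt_gaussSmooth hg hB hv
  obtain ⟨B', hB'⟩ := gaussSmoothDeriv_bounded hB v
  have hL' := gaussSmoothDeriv_lipschitz hK hL hg hB hv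
  have hcont : Continuous (gaussSmoothDeriv v g) := by
    refine LipschitzWith.continuous (K := (K / √v).toNNReal) (LipschitzWith.of_dist_le_mul ?_)
    intro x y
    rw [Real.dist_eq, Real.dist_eq, Real.coe_toNNReal _ (by positivity)]
    exact hL' x y
  have hcont0 : Continuous (gaussSmooth v g) :=
    continuous_iff_continuousAt.2 fun s => (hd s).continuousAt
  refine ⟨gaussSmooth v (gaussSmoothDeriv v g), gaussSmoothDeriv v (gaussSmoothDeriv v g),
    fun s => ?_, fun s => hasDerivAt_gaussSmooth hcont hB' hv s, fun x y => ?_⟩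
  · refine (hasDerivAt_integral_of_dominated_loc_of_deriv_le (μ := gaussianReal 0 v)
      (F := fun s w => gaussSmooth v g (s + w)) (F' := fun s w => gaussSmoothDeriv v g (s + w))
      (x₀ := s) (s := univ) (bound := fun _ => B') Filter.univ_mem ?_ ?_ ?_ ?_ ?_ ?_).2
    · exact Filter.Eventually.of_forall fun s =>
        (hcont0.comp (continuous_const.add continuous_id)).measurable.aestronglyMeasurable
    · exact integrable_of_continuous_of_bounded
        (hcont0.comp (continuous_const.add continuous_id)) fun w => gaussSmooth_bounded hB v _
    · exact (hcont.comp (continuous_const.add continuous_id)).measurable.aestronglyMeasurable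
    · exact ae_of_all _ fun w s _ => hB' _
    · exact integrable_const _
    · exact ae_of_all _ fun w s _ => (hd (s + w)).comp_add_const s w
  · have := gaussSmoothDeriv_lipschitz (by positivity) hL' hcont hB' hv x y
    rwa [div_div, Real.mul_self_sqrt v.coe_nonneg] at this

lemma taylor_one_of_lipschitz {G' G'' : ℝ → ℝ} {L : ℝ} (hL0 : 0 ≤ L)
    (h2 : ∀ s, HasDerivAt G' (G'' s) s) (hL : ∀ x y, |G'' x - G'' y| ≤ L * |x - y|) (x y : ℝ) :
    |G' (x + y) - G' x - y * G'' x| ≤ L * |y| ^ 2 := by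
  have hd : ∀ t ∈ uIcc 0 y, HasDerivWithinAt (fun t => G' (x + t) - t * G'' x)
      (G'' (x + t) - G'' x) (uIcc 0 y) t := fun t _ => by
    exact ((((h2 (x + t)).comp_const_add x t).fun_sub
      ((hasDerivAt_id t).mul_const (G'' x))).congr_deriv (by simp)).hasDerivWithinAt
  have := (convex_uIcc (0 : ℝ) y).norm_image_sub_le_of_norm_hasDerivWithin_le (C := L * |y|) hd
    (fun t ht => ?_) left_mem_uIcc right_mem_uIcc
  · simp only [add_zero, zero_mul, sub_zero, Real.norm_eq_abs] at this
    calc _ = |G' (x + y) - y * G'' x - G' x| := by congr 1; ring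
      _ ≤ _ := this
      _ = _ := by ring
  · refine (hL _ _).trans ?_
    have : |t| ≤ |y| := by
      have := abs_sub_left_of_mem_uIcc ht
      simpa using this
    rw [add_sub_cancel_left]
    gcongr

lemma taylor_two_of_lipschitz {G G' G'' : ℝ → ℝ} {L : ℝ} (hL0 : 0 ≤ L)
    (h1 : ∀ s, HasDerivAt G (G' s) s)
    (h2 : ∀ s, HasDerivAt G' (G'' s) s) (hL : ∀ x y, |G'' x - G'' y| ≤ L * |x - y|) (x y : ℝ) :
    |G (x + y) - G x - y * G' x - y ^ 2 / 2 * G'' x| ≤ L * |y| ^ 3 := by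
  have hd : ∀ t ∈ uIcc 0 y, HasDerivWithinAt (fun t => G (x + t) - t * G' x - t ^ 2 / 2 * G'' x)
      (G' (x + t) - G' x - t * G'' x) (uIcc 0 y) t := fun t _ => by
    exact (((((h1 (x + t)).comp_const_add x t).fun_sub ((hasDerivAt_id t).mul_const (G' x))).fun_sub
      ((((hasDerivAt_id t).fun_pow 2).div_const 2).mul_const (G'' x))).congr_deriv
      (by simp)).hasDerivWithinAt
  have := (convex_uIcc (0 : ℝ) y).norm_image_sub_le_of_norm_hasDerivWithin_le (C := L * |y| ^ 2) hd
    (fun t ht => ?_) left_mem_uIcc right_mem_uIcc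
  · simp only [add_zero, zero_mul, sub_zero, Real.norm_eq_abs] at this
    calc _ = |G (x + y) - y * G' x - y ^ 2 / 2 * G'' x - G x| := by congr 1; ring
      _ ≤ L * |y| ^ 2 * |y| := by simpa using this
      _ = _ := by ring
  · refine (taylor_one_of_lipschitz hL0 h2 hL x t).trans ?_
    have : |t| ≤ |y| := by
      have := abs_sub_left_of_mem_uIcc ht
      simpa using this
    gcongr

/-- The third absolute moment of the standard Gaussian distribution on `ℝ`. -/
def gaussThirdMoment : ℝ := ∫ w, |w| ^ 3 ∂(gaussianReal 0 1)

lemma gaussThirdMoment_nonneg : 0 ≤ gaussThirdMoment :=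
  integral_nonneg fun _ => by positivity

lemma integral_abs_pow_three_gaussianReal (v : ℝ≥0) :
    ∫ w, |w| ^ 3 ∂(gaussianReal 0 v) = √v ^ 3 * gaussThirdMoment := by
  have h := gaussianReal_map_const_mul (μ := 0) (v := 1) (√(v : ℝ))
  have h2 : (.mk (√(v : ℝ) ^ 2) (sq_nonneg _) : ℝ≥0) * 1 = v := by
    ext
    simp
  rw [mul_zero, h2] at h
  rw [← h, integral_map (by fun_prop) (by fun_prop), gaussThirdMoment, ← integral_const_mul]
  refine integral_congr_ae (ae_of_all _ fun w => ?_)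
  simp only [abs_mul, mul_pow, abs_of_nonneg (Real.sqrt_nonneg _)]

lemma integral_sq_gaussianReal (v : ℝ≥0) : ∫ w, w ^ 2 ∂(gaussianReal 0 v) = v := by
  have := variance_fun_id_gaussianReal (μ := 0) (v := v)
  rw [variance_eq_integral (by fun_prop)] at this
  simpa using this

lemma integrable_pow_gaussianReal (v : ℝ≥0) (k : ℕ) :
    Integrable (fun w : ℝ => w ^ k) (gaussianReal 0 v) :=
  (integrable_norm_iff (by fun_prop)).1 (by simpa using integrable_pow_abs_gaussianReal v k)

lemma abs_integral_gaussianReal_sub_le {G G' G'' : ℝ → ℝ} {L B : ℝ} (hL0 : 0 ≤ L)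
    (hB : ∀ x, |G x| ≤ B) (h1 : ∀ s, HasDerivAt G (G' s) s)
    (h2 : ∀ s, HasDerivAt G' (G'' s) s) (hL : ∀ x y, |G'' x - G'' y| ≤ L * |x - y|)
    (u : ℝ≥0) (y : ℝ) :
    |(∫ w, G (y + w) ∂(gaussianReal 0 u)) - G y - u / 2 * G'' y|
      ≤ L * (√u ^ 3 * gaussThirdMoment) := by
  have hG : Continuous G := continuous_iff_continuousAt.2 fun s => (h1 s).continuousAt
  have i0 : Integrable (fun w => G (y + w)) (gaussianReal 0 u) :=
    integrable_of_continuous_of_bounded (hG.comp (continuous_const.add continuous_id))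
      fun _ => hB _
  have i1 : Integrable (fun w : ℝ => w * G' y) (gaussianReal 0 u) := by
    simpa using (integrable_pow_gaussianReal u 1).mul_const (G' y)
  have i2 : Integrable (fun w : ℝ => w ^ 2 / 2 * G'' y) (gaussianReal 0 u) :=
    ((integrable_pow_gaussianReal u 2).div_const 2).mul_const _
  have e : (∫ w, G (y + w) ∂(gaussianReal 0 u)) - G y - u / 2 * G'' y
      = ∫ w, (G (y + w) - G y - w * G' y - w ^ 2 / 2 * G'' y) ∂(gaussianReal 0 u) := by
    have j1 : Integrable (fun w => G (y + w) - G y) (gaussianReal 0 u) :=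
      i0.sub (integrable_const _)
    have j2 : Integrable (fun w => G (y + w) - G y - w * G' y) (gaussianReal 0 u) := j1.sub i1
    rw [integral_sub j2 i2, integral_sub j1 i1, integral_sub i0 (integrable_const _),
      integral_mul_const, integral_mul_const, integral_div, integral_sq_gaussianReal,
      integral_id_gaussianReal]
    simp
  rw [e, ← integral_abs_pow_three_gaussianReal, ← integral_const_mul, ← Real.norm_eq_abs]
  refine norm_integral_le_of_norm_le ((integrable_pow_abs_gaussianReal u 3).const_mul L)
    (ae_of_all _ fun w => ?_)
  exact taylor_two_of_lipschitz hL0 h1 h2 hL y w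

/-- The constant in the one-dimensional comparison of a bounded variable with its partial
Gaussian replacement. -/
def swapConst : ℝ := 4 + gaussThirdMoment

lemma swapConst_pos : 0 < swapConst := by
  have := gaussThirdMoment_nonneg
  unfold swapConst
  linarith

lemma abs_swap_remainder_le {L a b s v x r c I g₀ g₁ d₀ d₁ e₀ e₁ : ℝ} (hL0 : 0 ≤ L) (ha0 : 0 ≤ a)
    (hab : a ≤ b) (hb1 : b ≤ 1) (hs : s = (b - a) * (b + a)) (hv0 : 0 ≤ v) (hv1 : v ≤ 1)
    (hx : |x| ≤ 1) (hr : r ^ 3 ≤ s) (hc : 0 ≤ c)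
    (T1 : |g₁ - g₀ - (b - a) * x * d₁ - ((b - a) * x) ^ 2 / 2 * e₁| ≤ L * |(b - a) * x| ^ 3)
    (T2 : |d₁ - d₀ - a * x * e₀| ≤ L * |a * x| ^ 2) (T3 : |e₁ - e₀| ≤ L * |a * x|)
    (T4 : |I - g₀ - s * v / 2 * e₁| ≤ L * (r ^ 3 * c)) :
    |g₁ - I - (b - a) * x * d₀ - s / 2 * (x ^ 2 - v) * e₀| ≤ L * (4 + c) * s := by
  have hx0 := abs_nonneg x
  have hba0 : 0 ≤ b - a := by linarith
  have hs0 : 0 ≤ s := by rw [hs]; exact mul_nonneg hba0 (by linarith)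
  have hd : |(b - a) * x| ≤ b - a := by
    rw [abs_mul, abs_of_nonneg hba0]
    exact mul_le_of_le_one_right hba0 hx
  have hy : |a * x| ≤ a := by
    rw [abs_mul, abs_of_nonneg ha0]
    exact mul_le_of_le_one_right ha0 hx
  have hba : (b - a) ^ 2 ≤ s := by
    rw [hs, sq]
    exact mul_le_mul_of_nonneg_left (by linarith) hba0
  have key : g₁ - I - (b - a) * x * d₀ - s / 2 * (x ^ 2 - v) * e₀
      = (g₁ - g₀ - (b - a) * x * d₁ - ((b - a) * x) ^ 2 / 2 * e₁)
        + (b - a) * x * (d₁ - d₀ - a * x * e₀)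
        + (((b - a) * x) ^ 2 / 2 - s * v / 2) * (e₁ - e₀)
        - (I - g₀ - s * v / 2 * e₁) := by
    rw [hs]
    ring
  rw [key]
  have B1 : L * |(b - a) * x| ^ 3 ≤ L * s := by
    refine mul_le_mul_of_nonneg_left ?_ hL0
    calc |(b - a) * x| ^ 3 ≤ (b - a) ^ 3 := pow_le_pow_left₀ (abs_nonneg _) hd 3
      _ = (b - a) ^ 2 * (b - a) := by ring
      _ ≤ s * 1 := mul_le_mul hba (by linarith) hba0 hs0
      _ = s := mul_one s
  have B2 : |(b - a) * x * (d₁ - d₀ - a * x * e₀)| ≤ L * s := by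
    rw [abs_mul]
    calc |(b - a) * x| * |d₁ - d₀ - a * x * e₀|
        ≤ (b - a) * (L * a ^ 2) := by
          have h : |a * x| ^ 2 ≤ a ^ 2 := pow_le_pow_left₀ (abs_nonneg _) hy 2
          exact mul_le_mul hd (T2.trans (mul_le_mul_of_nonneg_left h hL0)) (abs_nonneg _) hba0
      _ = L * ((b - a) * a ^ 2) := by ring
      _ ≤ L * s := by
        refine mul_le_mul_of_nonneg_left ?_ hL0
        rw [hs]
        refine mul_le_mul_of_nonneg_left ?_ hba0
        nlinarith
  have B3 : |(((b - a) * x) ^ 2 / 2 - s * v / 2) * (e₁ - e₀)| ≤ 2 * (L * s) := by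
    rw [abs_mul]
    have h5 : |((b - a) * x) ^ 2 / 2 - s * v / 2| ≤ 2 * s := by
      have e1 : ((b - a) * x) ^ 2 ≤ s := by
        rw [← sq_abs]
        exact (pow_le_pow_left₀ (abs_nonneg _) hd 2).trans hba
      have e2 : s * v ≤ s := mul_le_of_le_one_right hs0 hv1
      have e3 : 0 ≤ s * v := mul_nonneg hs0 hv0
      have e4 := sq_nonneg ((b - a) * x)
      rw [abs_le]
      constructor <;> linarith
    have h6 : |e₁ - e₀| ≤ L * 1 := T3.trans (mul_le_mul_of_nonneg_left (by linarith) hL0)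
    calc _ ≤ 2 * s * (L * 1) := mul_le_mul h5 h6 (abs_nonneg _) (by positivity)
      _ = _ := by ring
  have B4 : L * (r ^ 3 * c) ≤ L * (s * c) :=
    mul_le_mul_of_nonneg_left (mul_le_mul_of_nonneg_right hr hc) hL0
  refine (abs_sub _ _).trans ?_
  have A1 := abs_add_three (g₁ - g₀ - (b - a) * x * d₁ - ((b - a) * x) ^ 2 / 2 * e₁)
    ((b - a) * x * (d₁ - d₀ - a * x * e₀)) ((((b - a) * x) ^ 2 / 2 - s * v / 2) * (e₁ - e₀))
  linarith

lemma abs_smooth_swap_pointwise_le {G G' G'' : ℝ → ℝ} {L B : ℝ} (hL0 : 0 ≤ L)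
    (hB : ∀ x, |G x| ≤ B) (h1 : ∀ s, HasDerivAt G (G' s) s)
    (h2 : ∀ s, HasDerivAt G' (G'' s) s) (hL : ∀ x y, |G'' x - G'' y| ≤ L * |x - y|)
    {v t s : ℝ≥0} (hv : v ≤ 1) (hts : t + s ≤ 1) {x : ℝ} (hx : |x| ≤ 1) :
    |G (√(t + s : ℝ) * x) - (∫ w, G (√(t : ℝ) * x + w) ∂(gaussianReal 0 (s * v)))
      - (√(t + s : ℝ) - √(t : ℝ)) * x * G' 0 - s / 2 * (x ^ 2 - v) * G'' 0|
      ≤ L * swapConst * s := by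
  have ht0 : (0 : ℝ) ≤ t := t.coe_nonneg
  have hs0 : (0 : ℝ) ≤ s := s.coe_nonneg
  have hv0 : (0 : ℝ) ≤ v := v.coe_nonneg
  have hv1 : (v : ℝ) ≤ 1 := by exact_mod_cast hv
  have hts1 : (t + s : ℝ) ≤ 1 := by exact_mod_cast hts
  have hbb : √(t + s : ℝ) * √(t + s : ℝ) = t + s := Real.mul_self_sqrt (by positivity)
  have haa : √(t : ℝ) * √(t : ℝ) = t := Real.mul_self_sqrt ht0
  have T1 := taylor_two_of_lipschitz hL0 h1 h2 hL (√(t : ℝ) * x)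
    ((√(t + s : ℝ) - √(t : ℝ)) * x)
  have T2 := taylor_one_of_lipschitz hL0 h2 hL 0 (√(t : ℝ) * x)
  have T3 := hL (√(t : ℝ) * x) 0
  have T4 := abs_integral_gaussianReal_sub_le hL0 hB h1 h2 hL (s * v) (√(t : ℝ) * x)
  rw [← add_mul, add_sub_cancel] at T1
  rw [zero_add] at T2
  rw [sub_zero] at T3
  rw [NNReal.coe_mul] at T4
  have hsv : √((s : ℝ) * v) ^ 3 ≤ s := by
    have h0 : 0 ≤ (s : ℝ) * v := mul_nonneg hs0 hv0
    have hle : (s : ℝ) * v ≤ s := mul_le_of_le_one_right hs0 hv1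
    have : √((s : ℝ) * v) ≤ 1 := Real.sqrt_le_one.2 (by linarith)
    calc √((s : ℝ) * v) ^ 3 = √((s : ℝ) * v) * √((s : ℝ) * v) * √((s : ℝ) * v) := by ring
      _ = s * v * √((s : ℝ) * v) := by rw [Real.mul_self_sqrt h0]
      _ ≤ s * 1 := mul_le_mul hle this (Real.sqrt_nonneg _) hs0
      _ = s := mul_one _
  exact abs_swap_remainder_le hL0 (Real.sqrt_nonneg _) (Real.sqrt_le_sqrt (by linarith))
    (Real.sqrt_le_one.2 hts1) (by linarith) hv0 hv1 hx hsv gaussThirdMoment_nonneg T1 T2 T3 T4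

/-- Comparison of a centered bounded law, scaled by `√(t + s)`, with its scaling by `√t` plus an
independent Gaussian with the missing variance, for smooth test functions. -/
lemma abs_integral_smooth_swap_le {G G' G'' : ℝ → ℝ} {L B : ℝ} (hL0 : 0 ≤ L)
    (hB : ∀ x, |G x| ≤ B) (h1 : ∀ s, HasDerivAt G (G' s) s)
    (h2 : ∀ s, HasDerivAt G' (G'' s) s) (hL : ∀ x y, |G'' x - G'' y| ≤ L * |x - y|)
    {ν : Measure ℝ} [IsProbabilityMeasure ν] (hν : ∀ᵐ x ∂ν, |x| ≤ 1)
    {v t s : ℝ≥0} (hm : ∫ x, x ∂ν = 0) (hv : ∫ x, x ^ 2 ∂ν = v) (hv1 : v ≤ 1)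
    (hts : t + s ≤ 1) :
    |(∫ x, G x ∂(ν.map (√(t + s : ℝ) * ·)))
      - ∫ x, G x ∂((ν.map (√(t : ℝ) * ·)) ∗ gaussianReal 0 (s * v))| ≤ L * swapConst * s := by
  have hG : Continuous G := continuous_iff_continuousAt.2 fun s => (h1 s).continuousAt
  have : IsProbabilityMeasure (ν.map (√(t : ℝ) * ·)) :=
    Measure.isProbabilityMeasure_map (by fun_prop)
  have hcont : Continuous (fun y => ∫ w, G (y + w) ∂(gaussianReal 0 (s * v))) := by
    refine continuous_of_dominated (bound := fun _ => B) (fun y => ?_) (fun y => ?_)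
      (integrable_const _) ?_
    · exact (hG.comp (continuous_const.add continuous_id)).measurable.aestronglyMeasurable
    · exact ae_of_all _ fun w => hB _
    · exact ae_of_all _ fun w => hG.comp (continuous_id.add continuous_const)
  have hbdd : ∀ y, |∫ w, G (y + w) ∂(gaussianReal 0 (s * v))| ≤ B := fun y =>
    gaussSmooth_bounded hB _ y
  rw [integral_conv (integrable_of_continuous_of_bounded hG hB),
    integral_map (by fun_prop) hG.measurable.aestronglyMeasurable,
    integral_map (by fun_prop) hcont.measurable.aestronglyMeasurable]
  have i1 : Integrable (fun x => G (√(t + s : ℝ) * x)) ν :=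
    integrable_of_continuous_of_bounded (hG.comp (continuous_const.mul continuous_id))
      fun _ => hB _
  have i2 : Integrable (fun x => ∫ w, G (√(t : ℝ) * x + w) ∂(gaussianReal 0 (s * v))) ν :=
    integrable_of_continuous_of_bounded (hcont.comp (continuous_const.mul continuous_id))
      fun _ => hbdd _
  have ix : Integrable (fun x : ℝ => x) ν := Integrable.of_bound (by fun_prop) 1 hν
  have ix2 : Integrable (fun x : ℝ => x ^ 2) ν := by
    refine Integrable.of_bound (by fun_prop) 1 ?_
    filter_upwards [hν] with x hx
    rw [Real.norm_eq_abs, abs_pow]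
    exact pow_le_one₀ (abs_nonneg _) hx
  have i3 : Integrable (fun x : ℝ => (√(t + s : ℝ) - √(t : ℝ)) * x * G' 0) ν :=
    (ix.const_mul _).mul_const _
  have i4 : Integrable (fun x : ℝ => (s : ℝ) / 2 * (x ^ 2 - v) * G'' 0) ν :=
    ((ix2.sub (integrable_const _)).const_mul _).mul_const _
  have e : (∫ x, G (√(t + s : ℝ) * x) ∂ν)
        - ∫ x, ∫ w, G (√(t : ℝ) * x + w) ∂(gaussianReal 0 (s * v)) ∂ν
      = ∫ x, (G (√(t + s : ℝ) * x) - (∫ w, G (√(t : ℝ) * x + w) ∂(gaussianReal 0 (s * v)))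
      - (√(t + s : ℝ) - √(t : ℝ)) * x * G' 0 - s / 2 * (x ^ 2 - v) * G'' 0) ∂ν := by
    have j1 : Integrable (fun x => G (√(t + s : ℝ) * x)
        - ∫ w, G (√(t : ℝ) * x + w) ∂(gaussianReal 0 (s * v))) ν := i1.sub i2
    have j2 : Integrable (fun x => G (√(t + s : ℝ) * x)
        - (∫ w, G (√(t : ℝ) * x + w) ∂(gaussianReal 0 (s * v)))
        - (√(t + s : ℝ) - √(t : ℝ)) * x * G' 0) ν := j1.sub i3
    rw [integral_sub j2 i4, integral_sub j1 i3, integral_sub i1 i2,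
      integral_mul_const, integral_mul_const, integral_const_mul, integral_const_mul,
      integral_sub ix2 (integrable_const _), hm, hv]
    simp
  rw [e, ← Real.norm_eq_abs]
  have := norm_integral_le_of_norm_le_const (μ := ν) (C := L * swapConst * s)
    (f := fun x => G (√(t + s : ℝ) * x)
      - (∫ w, G (√(t : ℝ) * x + w) ∂(gaussianReal 0 (s * v)))
      - (√(t + s : ℝ) - √(t : ℝ)) * x * G' 0 - s / 2 * (x ^ 2 - v) * G'' 0) ?_
  · simpa using this
  · filter_upwards [hν] with x hx
    exact abs_smooth_swap_pointwise_le hL0 hB h1 h2 hL hv1 hts hx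

/-- The same comparison for Lipschitz test functions, after an additional Gaussian smoothing. -/
lemma abs_integral_swap_conv_gaussianReal_le {g : ℝ → ℝ} {K B : ℝ} (hK : 0 ≤ K)
    (hL : ∀ x y, |g x - g y| ≤ K * |x - y|) (hg : Continuous g)
    (hB : ∀ x, |g x| ≤ B) {q : ℝ≥0} (hq : q ≠ 0)
    {ν : Measure ℝ} [IsProbabilityMeasure ν] (hν : ∀ᵐ x ∂ν, |x| ≤ 1)
    {v t s : ℝ≥0} (hm : ∫ x, x ∂ν = 0) (hv : ∫ x, x ^ 2 ∂ν = v) (hv1 : v ≤ 1)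
    (hts : t + s ≤ 1) :
    |(∫ x, g x ∂(ν.map (√(t + s : ℝ) * ·) ∗ gaussianReal 0 q))
      - ∫ x, g x ∂((ν.map (√(t : ℝ) * ·)) ∗ gaussianReal 0 (s * v) ∗ gaussianReal 0 q)|
      ≤ 2 * K / q * swapConst * s := by
  have hq2 : q / 2 ≠ 0 := by positivity
  obtain ⟨G', G'', h1, h2, h3⟩ := exists_derivs_gaussSmooth_gaussSmooth hK hL hg hB hq2
  have : IsProbabilityMeasure (ν.map (√(t : ℝ) * ·)) :=
    Measure.isProbabilityMeasure_map (by fun_prop)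
  have : IsProbabilityMeasure (ν.map (√(t + s : ℝ) * ·)) :=
    Measure.isProbabilityMeasure_map (by fun_prop)
  have hs0 : Continuous (gaussSmooth (q / 2) g) :=
    continuous_iff_continuousAt.2 fun s => (hasDerivAt_gaussSmooth hg hB hq2 s).continuousAt
  have hsm : ∀ (α : Measure ℝ) [IsProbabilityMeasure α],
      ∫ x, g x ∂(α ∗ gaussianReal 0 q)
        = ∫ x, gaussSmooth (q / 2) (gaussSmooth (q / 2) g) x ∂α := by
    intro α _
    have hN : gaussianReal 0 q = gaussianReal 0 (q / 2) ∗ gaussianReal 0 (q / 2) := by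
      rw [gaussianReal_conv_gaussianReal]
      simp
    rw [hN, integral_conv (integrable_of_continuous_of_bounded hg hB)]
    refine integral_congr_ae (ae_of_all _ fun x => ?_)
    simp only
    have hg' : Continuous fun y => g (x + y) := by fun_prop
    rw [integral_conv (integrable_of_continuous_of_bounded hg' fun _ => hB _)]
    simp [gaussSmooth, add_assoc]
  have := abs_integral_smooth_swap_le (L := K / ((q / 2 : ℝ≥0) : ℝ)) (by positivity)
    (gaussSmooth_bounded (gaussSmooth_bounded hB _) _) h1 h2 h3 hν hm hv hv1 hts
  rw [hsm, ← Measure.conv_assoc, hsm]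
  convert this using 2
  push_cast
  field_simp

/-- The centered Gaussian distribution on `ℝ^p` with covariance `r` times the identity. -/
def isoGaussian (p : ℕ) (r : ℝ≥0) : Measure (Euc p) :=
  (ProbabilityTheory.stdGaussian (Euc p)).map (fun z => √(r : ℝ) • z)

instance (r : ℝ≥0) : IsProbabilityMeasure (isoGaussian p r) :=
  Measure.isProbabilityMeasure_map (by fun_prop)

lemma charFun_isoGaussian (r : ℝ≥0) (u : Euc p) :
    charFun (isoGaussian p r) u = Complex.exp (-(r * ‖u‖ ^ 2) / 2 : ℝ) := by
  rw [isoGaussian, charFun_map_smul, charFun_stdGaussian, ← Complex.ofReal_pow, norm_smul, mul_pow,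
    Real.norm_eq_abs, sq_abs, Real.sq_sqrt r.coe_nonneg]
  push_cast
  rfl

/-- The centered Gaussian distribution on `ℝ^p` with covariance `r` times the projection onto the
orthogonal complement of `a`. -/
def perpGaussian (r : ℝ≥0) (a : Euc p) : Measure (Euc p) :=
  (ProbabilityTheory.stdGaussian (Euc p)).map (fun z => √(r : ℝ) • (z - (⟪a, z⟫ / ‖a‖ ^ 2) • a))

instance (r : ℝ≥0) (a : Euc p) : IsProbabilityMeasure (perpGaussian r a) :=
  Measure.isProbabilityMeasure_map (by fun_prop)

lemma charFun_perpGaussian (r : ℝ≥0) {a : Euc p} (ha : a ≠ 0) (u : Euc p) :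
    charFun (perpGaussian r a) u
      = Complex.exp (-(r * (‖u‖ ^ 2 - ⟪a, u⟫ ^ 2 / ‖a‖ ^ 2)) / 2 : ℝ) := by
  have ha' : ‖a‖ ≠ 0 := norm_ne_zero_iff.2 ha
  have h1 : charFun (perpGaussian r a) u
      = charFun (ProbabilityTheory.stdGaussian (Euc p))
        (√(r : ℝ) • (u - (⟪a, u⟫ / ‖a‖ ^ 2) • a)) := by
    rw [perpGaussian, charFun_apply, charFun_apply, integral_map (by fun_prop) (by fun_prop)]
    congr 1
    funext z
    congr 3
    rw [real_inner_smul_left, real_inner_smul_right, inner_sub_left, inner_sub_right,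
      real_inner_smul_left, real_inner_smul_right, real_inner_comm z a]
    ring
  have h2 : ‖√(r : ℝ) • (u - (⟪a, u⟫ / ‖a‖ ^ 2) • a)‖ ^ 2
      = r * (‖u‖ ^ 2 - ⟪a, u⟫ ^ 2 / ‖a‖ ^ 2) := by
    rw [norm_smul, mul_pow, Real.norm_eq_abs, sq_abs, Real.sq_sqrt r.coe_nonneg,
      norm_sub_sq_real, norm_smul, mul_pow, Real.norm_eq_abs, sq_abs, real_inner_smul_right,
      real_inner_comm u a]
    field_simp
    ring
  rw [h1, charFun_stdGaussian, ← Complex.ofReal_pow, h2]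
  push_cast
  rfl

lemma charFun_map_smul_vec (ν : Measure ℝ) (a u : Euc p) :
    charFun (ν.map (fun x => x • a)) u = charFun ν ⟪a, u⟫ := by
  rw [charFun_apply, charFun_apply_real, integral_map (by fun_prop) (by fun_prop)]
  congr 1
  funext x
  rw [real_inner_smul_left]
  congr 2
  push_cast
  ring

lemma charFun_gaussianReal_zero (v : ℝ≥0) (x : ℝ) :
    charFun (gaussianReal 0 v) x = Complex.exp (-(v * x ^ 2) / 2 : ℝ) := by
  rw [charFun_gaussianReal]
  push_cast
  congr 1
  ring

instance isProbabilityMeasure_map_smul_vec (ν : Measure ℝ) [IsProbabilityMeasure ν] (a : Euc p) :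
    IsProbabilityMeasure (ν.map (fun x => x • a)) :=
  Measure.isProbabilityMeasure_map (by fun_prop)

instance isProbabilityMeasure_map_const_mul (ν : Measure ℝ) [IsProbabilityMeasure ν] (c : ℝ) :
    IsProbabilityMeasure (ν.map (c * ·)) :=
  Measure.isProbabilityMeasure_map (by fun_prop)

/-- Splitting an isotropic Gaussian along a direction. -/
lemma map_smul_conv_isoGaussian (ν : Measure ℝ) [IsProbabilityMeasure ν] {a : Euc p} (ha : a ≠ 0)
    (r : ℝ≥0) :
    (ν.map (fun x => x • a)) ∗ isoGaussian p r
      = perpGaussian r a ∗ ((ν ∗ gaussianReal 0 (r / ‖a‖₊ ^ 2)).map (fun x => x • a)) := by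
  refine Measure.ext_of_charFun ?_
  funext u
  rw [charFun_conv, charFun_conv, charFun_map_smul_vec, charFun_map_smul_vec, charFun_conv,
    charFun_isoGaussian, charFun_perpGaussian r ha, charFun_gaussianReal_zero]
  rw [mul_left_comm, ← Complex.exp_add, ← Complex.ofReal_add]
  congr 4
  push_cast
  ring

lemma abs_integral_swap_conv_isoGaussian_le {h : Euc p → ℝ} (hL : LipschitzWith 1 h) {B : ℝ}
    (hB : ∀ x, |h x| ≤ B) {r : ℝ≥0} (hr : r ≠ 0) (a : Euc p)
    {ν : Measure ℝ} [IsProbabilityMeasure ν] (hν : ∀ᵐ x ∂ν, |x| ≤ 1)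
    {v t s : ℝ≥0} (hm : ∫ x, x ∂ν = 0) (hv : ∫ x, x ^ 2 ∂ν = v) (hv1 : v ≤ 1)
    (hts : t + s ≤ 1) :
    |(∫ x, h x ∂(((ν.map (√(t + s : ℝ) * ·)).map (fun x => x • a)) ∗ isoGaussian p r))
      - ∫ x, h x ∂((((ν.map (√(t : ℝ) * ·)) ∗ gaussianReal 0 (s * v)).map (fun x => x • a))
        ∗ isoGaussian p r)|
      ≤ 2 * swapConst * s / r * ‖a‖ ^ 3 := by
  have hc := swapConst_pos
  rcases eq_or_ne a 0 with rfl | ha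
  · simp
  have hI : ∀ (P : Measure (Euc p)) [IsProbabilityMeasure P], Integrable h P := fun P _ =>
    integrable_of_continuous_of_bounded hL.continuous hB
  have han : ‖a‖ ≠ 0 := norm_ne_zero_iff.2 ha
  have hq : r / ‖a‖₊ ^ 2 ≠ 0 := by
    have : ‖a‖₊ ≠ 0 := nnnorm_ne_zero_iff.2 ha
    positivity
  rw [map_smul_conv_isoGaussian _ ha, map_smul_conv_isoGaussian _ ha, integral_conv (hI _),
    integral_conv (hI _)]
  have hcont : ∀ (P : Measure (Euc p)) [IsProbabilityMeasure P],
      Continuous fun x => ∫ y, h (x + y) ∂P := fun P _ => by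
    refine continuous_of_dominated (bound := fun _ => B) (fun y => ?_) (fun y => ?_)
      (integrable_const _) ?_
    · exact (hL.continuous.comp (continuous_const.add
        continuous_id)).measurable.aestronglyMeasurable
    · exact ae_of_all _ fun w => hB _
    · exact ae_of_all _ fun w => hL.continuous.comp (continuous_id.add continuous_const)
  have hbd : ∀ (P : Measure (Euc p)) [IsProbabilityMeasure P] (x : Euc p),
      |∫ y, h (x + y) ∂P| ≤ B := fun P _ x => by
    have := norm_integral_le_of_norm_le_const (μ := P)
      (f := fun w => h (x + w)) (C := B) (ae_of_all _ fun w => hB _)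
    simpa using this
  rw [← integral_sub (integrable_of_continuous_of_bounded (hcont _) (hbd _))
    (integrable_of_continuous_of_bounded (hcont _) (hbd _)), ← Real.norm_eq_abs]
  refine (norm_integral_le_of_norm_le_const (C := 2 * swapConst * s / r * ‖a‖ ^ 3)
    (ae_of_all _ fun z => ?_)).trans (by simp)
  have hzc : Continuous fun y => h (z + y) :=
    hL.continuous.comp (continuous_const.add continuous_id)
  rw [integral_map (by fun_prop) hzc.measurable.aestronglyMeasurable,
    integral_map (by fun_prop) hzc.measurable.aestronglyMeasurable, Measure.conv_assoc]
  have := abs_integral_swap_conv_gaussianReal_le (g := fun x => h (z + x • a)) (K := ‖a‖)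
    (norm_nonneg _) (fun x y => ?_) (hzc.comp (continuous_id.smul continuous_const))
    (fun x => hB _) hq hν hm hv hv1 hts
  · refine this.trans (le_of_eq ?_)
    push_cast
    field_simp
  · have := hL.dist_le_mul (z + x • a) (z + y • a)
    rw [Real.dist_eq, dist_eq_norm, add_sub_add_left_eq_sub, ← sub_smul, norm_smul,
      Real.norm_eq_abs] at this
    simpa [mul_comm] using this

/-- Convolution of the first `n` measures of a sequence. -/
def iterConv (ρ : ℕ → Measure (Euc p)) : ℕ → Measure (Euc p)
  | 0 => Measure.dirac 0
  | n + 1 => iterConv ρ n ∗ ρ n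

instance isProbabilityMeasure_iterConv (ρ : ℕ → Measure (Euc p)) [∀ i, IsProbabilityMeasure (ρ i)]
    (n : ℕ) : IsProbabilityMeasure (iterConv ρ n) := by
  induction n with
  | zero => exact Measure.dirac.isProbabilityMeasure
  | succ n ih =>
    rw [iterConv]
    infer_instance

lemma charFun_iterConv (ρ : ℕ → Measure (Euc p)) [∀ i, IsProbabilityMeasure (ρ i)]
    (n : ℕ) (u : Euc p) :
    charFun (iterConv ρ n) u = ∏ i ∈ Finset.range n, charFun (ρ i) u := by
  induction n with
  | zero => simp [iterConv]
  | succ n ih => rw [iterConv, charFun_conv, ih, Finset.prod_range_succ]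

lemma abs_integral_conv_sub_le {h : Euc p → ℝ} (hc : Continuous h) {B : ℝ}
    (hB : ∀ x, |h x| ≤ B) (Q P P' : Measure (Euc p)) [IsProbabilityMeasure Q]
    [IsProbabilityMeasure P] [IsProbabilityMeasure P'] {e : ℝ}
    (he : ∀ b, |(∫ x, h (b + x) ∂P) - ∫ x, h (b + x) ∂P'| ≤ e) (b : Euc p) :
    |(∫ x, h (b + x) ∂(Q ∗ P)) - ∫ x, h (b + x) ∂(Q ∗ P')| ≤ e := by
  have hcb : Continuous fun x => h (b + x) := by fun_prop
  have hcont : ∀ (P : Measure (Euc p)) [IsProbabilityMeasure P],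
      Continuous fun x => ∫ y, h (b + (x + y)) ∂P := fun P _ => by
    refine continuous_of_dominated (bound := fun _ => B) (fun y => ?_) (fun y => ?_)
      (integrable_const _) ?_
    · exact (by fun_prop : Continuous fun w => h (b + (y + w))).measurable.aestronglyMeasurable
    · exact ae_of_all _ fun w => hB _
    · exact ae_of_all _ fun w => by fun_prop
  have hbd : ∀ (P : Measure (Euc p)) [IsProbabilityMeasure P] (x : Euc p),
      |∫ y, h (b + (x + y)) ∂P| ≤ B := fun P _ x => by
    have := norm_integral_le_of_norm_le_const (μ := P)
      (f := fun w => h (b + (x + w))) (C := B) (ae_of_all _ fun w => hB _)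
    simpa using this
  rw [integral_conv (integrable_of_continuous_of_bounded hcb fun _ => hB _),
    integral_conv (integrable_of_continuous_of_bounded hcb fun _ => hB _),
    ← integral_sub (integrable_of_continuous_of_bounded (hcont _) (hbd _))
    (integrable_of_continuous_of_bounded (hcont _) (hbd _)), ← Real.norm_eq_abs]
  refine (norm_integral_le_of_norm_le_const (C := e) (ae_of_all _ fun z => ?_)).trans (by simp)
  simp only [← add_assoc]
  exact he (b + z)

/-- Lindeberg's replacement scheme. -/
lemma abs_integral_iterConv_sub_le {h : Euc p → ℝ} (hc : Continuous h) {B : ℝ}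
    (hB : ∀ x, |h x| ≤ B) (ρ ρ' : ℕ → Measure (Euc p)) [∀ i, IsProbabilityMeasure (ρ i)]
    [∀ i, IsProbabilityMeasure (ρ' i)] (Q : Measure (Euc p)) [IsProbabilityMeasure Q] {e : ℕ → ℝ}
    (he : ∀ i b, |(∫ x, h (b + x) ∂(ρ i ∗ Q)) - ∫ x, h (b + x) ∂(ρ' i ∗ Q)| ≤ e i)
    (n : ℕ) (b : Euc p) :
    |(∫ x, h (b + x) ∂(iterConv ρ n ∗ Q)) - ∫ x, h (b + x) ∂(iterConv ρ' n ∗ Q)|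
      ≤ ∑ i ∈ Finset.range n, e i := by
  induction n generalizing b with
  | zero => simp [iterConv]
  | succ n ih =>
    rw [Finset.sum_range_succ, iterConv, iterConv, Measure.conv_assoc, Measure.conv_assoc]
    have h1 := abs_integral_conv_sub_le hc hB (iterConv ρ n) (ρ n ∗ Q) (ρ' n ∗ Q) (he n) b
    have h2 := abs_integral_conv_sub_le hc hB (ρ' n) (iterConv ρ n ∗ Q) (iterConv ρ' n ∗ Q) ih b
    have e1 : ∀ R : Measure (Euc p), IsProbabilityMeasure R →
        ρ' n ∗ (R ∗ Q) = R ∗ (ρ' n ∗ Q) := fun R _ => by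
      rw [← Measure.conv_assoc, Measure.conv_comm (ρ' n) R, Measure.conv_assoc]
    rw [e1 _ inferInstance, e1 _ inferInstance] at h2
    calc _ ≤ _ := abs_sub_le _ (∫ x, h (b + x) ∂(iterConv ρ n ∗ (ρ' n ∗ Q))) _
      _ ≤ _ := by linarith

/-- The law of `∑ i < n, √t ξ i • a i`, where the `ξ i` are independent with laws `ν i`. -/
def scaledSumLaw (ν : ℕ → Measure ℝ) (a : ℕ → Euc p) (n : ℕ) (t : ℝ≥0) : Measure (Euc p) :=
  iterConv (fun i => ((ν i).map (√(t : ℝ) * ·)).map (fun x => x • a i)) n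

instance (ν : ℕ → Measure ℝ) [∀ i, IsProbabilityMeasure (ν i)] (a : ℕ → Euc p) (n : ℕ) (t : ℝ≥0) :
    IsProbabilityMeasure (scaledSumLaw ν a n t) := by
  rw [scaledSumLaw]; infer_instance

lemma charFun_scaledSumLaw (ν : ℕ → Measure ℝ) [∀ i, IsProbabilityMeasure (ν i)] (a : ℕ → Euc p)
    (n : ℕ) (t : ℝ≥0) (u : Euc p) :
    charFun (scaledSumLaw ν a n t) u
      = ∏ i ∈ Finset.range n, charFun (ν i) (√(t : ℝ) * ⟪a i, u⟫) := by
  rw [scaledSumLaw, charFun_iterConv]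
  simp_rw [charFun_map_smul_vec, charFun_map_mul]

lemma scaledSumLaw_eq_map_one (ν : ℕ → Measure ℝ) [∀ i, IsProbabilityMeasure (ν i)]
    (a : ℕ → Euc p) (n : ℕ) (t : ℝ≥0) :
    scaledSumLaw ν a n t = (scaledSumLaw ν a n 1).map (fun x => √(t : ℝ) • x) := by
  refine Measure.ext_of_charFun ?_
  funext u
  rw [charFun_map_smul, charFun_scaledSumLaw, charFun_scaledSumLaw]
  simp [real_inner_smul_right]

lemma iterConv_conv_isoGaussian (ν : ℕ → Measure ℝ) [∀ i, IsProbabilityMeasure (ν i)]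
    (a : ℕ → Euc p) (n : ℕ) (v : ℕ → ℝ≥0)
    (hsum : ∀ u, ∑ i ∈ Finset.range n, (v i : ℝ) * ⟪a i, u⟫ ^ 2 = ‖u‖ ^ 2) (t s r : ℝ≥0) :
    iterConv (fun i => (((ν i).map (√(t : ℝ) * ·)) ∗ gaussianReal 0 (s * v i)).map
        (fun x => x • a i)) n ∗ isoGaussian p r
      = scaledSumLaw ν a n t ∗ isoGaussian p (s + r) := by
  refine Measure.ext_of_charFun ?_
  funext u
  rw [charFun_conv, charFun_conv, charFun_scaledSumLaw, charFun_iterConv]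
  simp_rw [charFun_map_smul_vec, charFun_conv, charFun_map_mul, charFun_gaussianReal_zero,
    charFun_isoGaussian]
  rw [Finset.prod_mul_distrib, mul_assoc, ← Complex.exp_sum, ← Complex.exp_add,
    ← Complex.ofReal_sum, ← Complex.ofReal_add]
  congr 4
  have : ∑ i ∈ Finset.range n, -(((s * v i : ℝ≥0) : ℝ) * ⟪a i, u⟫ ^ 2) / 2
      = -(s / 2) * ∑ i ∈ Finset.range n, (v i : ℝ) * ⟪a i, u⟫ ^ 2 := by
    rw [Finset.mul_sum]
    refine Finset.sum_congr rfl fun i _ => ?_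
    push_cast
    ring
  rw [this, hsum]
  push_cast
  ring

section Bound

variable {ν : ℕ → Measure ℝ} [∀ i, IsProbabilityMeasure (ν i)] {a : ℕ → Euc p} {n : ℕ}
  {v : ℕ → ℝ≥0}

lemma abs_integral_scaledSumLaw_add_le {h : Euc p → ℝ} (hL : LipschitzWith 1 h) {B : ℝ}
    (hB : ∀ x, |h x| ≤ B) (hν : ∀ i, ∀ᵐ x ∂(ν i), |x| ≤ 1) (hm : ∀ i, ∫ x, x ∂(ν i) = 0)
    (hv : ∀ i, ∫ x, x ^ 2 ∂(ν i) = v i) (hv1 : ∀ i, v i ≤ 1)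
    (hsum : ∀ u, ∑ i ∈ Finset.range n, (v i : ℝ) * ⟪a i, u⟫ ^ 2 = ‖u‖ ^ 2)
    {t s r : ℝ≥0} (hr : r ≠ 0) (hts : t + s ≤ 1) :
    |(∫ x, h x ∂(scaledSumLaw ν a n (t + s) ∗ isoGaussian p r))
      - ∫ x, h x ∂(scaledSumLaw ν a n t ∗ isoGaussian p (s + r))|
      ≤ 2 * swapConst * s / r * ∑ i ∈ Finset.range n, ‖a i‖ ^ 3 := by
  rw [← iterConv_conv_isoGaussian ν a n v hsum t s r, Finset.mul_sum, scaledSumLaw]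
  have := abs_integral_iterConv_sub_le hL.continuous hB
    (fun i => ((ν i).map (√((t + s : ℝ≥0) : ℝ) * ·)).map (fun x => x • a i))
    (fun i => (((ν i).map (√(t : ℝ) * ·)) ∗ gaussianReal 0 (s * v i)).map (fun x => x • a i))
    (isoGaussian p r) (e := fun i => 2 * swapConst * s / r * ‖a i‖ ^ 3) (fun i b => ?_) n 0
  · simpa using this
  · have hLb : LipschitzWith 1 fun x => h (b + x) := by
      refine LipschitzWith.of_dist_le_mul fun x y => ?_
      simpa using hL.dist_le_mul (b + x) (b + y)
    push_cast
    exact abs_integral_swap_conv_isoGaussian_le hLb (fun x => hB _) hr (a i) (hν i) (hm i) (hv i)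
      (hv1 i) hts

lemma abs_integral_scaledSumLaw_dyadic_le {h : Euc p → ℝ} (hL : LipschitzWith 1 h) {B : ℝ}
    (hB : ∀ x, |h x| ≤ B) (hν : ∀ i, ∀ᵐ x ∂(ν i), |x| ≤ 1) (hm : ∀ i, ∫ x, x ∂(ν i) = 0)
    (hv : ∀ i, ∫ x, x ^ 2 ∂(ν i) = v i) (hv1 : ∀ i, v i ≤ 1)
    (hsum : ∀ u, ∑ i ∈ Finset.range n, (v i : ℝ) * ⟪a i, u⟫ ^ 2 = ‖u‖ ^ 2) (m : ℕ)
    {t r : ℝ≥0} (hr : r = (1 / 2) ^ m) (htr : t + r = 1) :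
    |(∫ x, h x ∂(scaledSumLaw ν a n t ∗ isoGaussian p r))
      - ∫ x, h x ∂(ProbabilityTheory.stdGaussian (Euc p))|
      ≤ m * (2 * swapConst * ∑ i ∈ Finset.range n, ‖a i‖ ^ 3) := by
  induction m generalizing t r with
  | zero =>
    have hr1 : r = 1 := by simpa using hr
    have ht0 : t = 0 := by
      rw [hr1] at htr
      exact add_eq_right.1 htr
    subst hr1 ht0
    have : scaledSumLaw ν a n 0 ∗ isoGaussian p 1 = ProbabilityTheory.stdGaussian (Euc p) := by
      refine Measure.ext_of_charFun ?_
      funext u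
      rw [charFun_conv, charFun_scaledSumLaw, charFun_isoGaussian, charFun_stdGaussian]
      simp
    simp [this]
  | succ m ih =>
    have hr0 : r ≠ 0 := by
      rw [hr]
      positivity
    have hrr : r + r = (1 / 2) ^ m := by
      rw [hr, pow_succ, ← mul_add, one_div, ← two_mul, mul_inv_cancel₀ two_ne_zero, mul_one]
    have hrt : r ≤ t := by
      have h1 : r + r ≤ t + r := by
        rw [htr, hrr]
        exact pow_le_one₀ (by positivity) (by norm_num)
      exact (add_le_add_iff_right r).1 h1
    obtain ⟨t', rfl⟩ := exists_add_of_le hrt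
    rw [add_comm r t'] at htr ⊢
    have h1 := abs_integral_scaledSumLaw_add_le hL hB hν hm hv hv1 hsum (t := t') (s := r) hr0
      (by rw [← htr]; exact le_self_add)
    have h2 := ih (t := t') hrr (by rw [← add_assoc, htr])
    have hr' : (r : ℝ) ≠ 0 := by exact_mod_cast hr0
    rw [mul_div_assoc, div_self hr', mul_one] at h1
    refine (abs_sub_le _ _ _).trans ((add_le_add h1 h2).trans (le_of_eq ?_))
    push_cast
    ring

/-- The mean norm of a standard Gaussian vector. -/
def gaussMeanNorm (p : ℕ) : ℝ := ∫ z, ‖z‖ ∂(ProbabilityTheory.stdGaussian (Euc p))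

lemma integrable_norm_stdGaussian :
    Integrable (fun z => ‖z‖) (ProbabilityTheory.stdGaussian (Euc p)) :=
  IsGaussian.integrable_id.norm

lemma abs_integral_map_smul_conv_sub_le {h : Euc p → ℝ} (hL : LipschitzWith 1 h) {B : ℝ}
    (hB : ∀ x, |h x| ≤ B) (P : Measure (Euc p)) [IsProbabilityMeasure P]
    (hP : Integrable (fun x => ‖x‖) P) {t r : ℝ≥0} (htr : t + r = 1) :
    |(∫ x, h x ∂(P.map (fun x => √(t : ℝ) • x) ∗ isoGaussian p r)) - ∫ x, h x ∂P|
      ≤ √(r : ℝ) * ((∫ x, ‖x‖ ∂P) + gaussMeanNorm p) := by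
  have hc := hL.continuous
  have : IsProbabilityMeasure (P.map (fun x => √(t : ℝ) • x)) :=
    Measure.isProbabilityMeasure_map (by fun_prop)
  have htr' : (t : ℝ) + r = 1 := by exact_mod_cast htr
  have hcont : ∀ (Q : Measure (Euc p)) [IsProbabilityMeasure Q],
      Continuous fun x => ∫ y, h (x + y) ∂Q := fun Q _ => by
    refine continuous_of_dominated (bound := fun _ => B) (fun y => ?_) (fun y => ?_)
      (integrable_const _) ?_
    · exact (by fun_prop : Continuous fun w => h (y + w)).measurable.aestronglyMeasurable
    · exact ae_of_all _ fun w => hB _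
    · exact ae_of_all _ fun w => by fun_prop
  have hbd : ∀ (Q : Measure (Euc p)) [IsProbabilityMeasure Q] (x : Euc p),
      |∫ y, h (x + y) ∂Q| ≤ B := fun Q _ x => by
    have := norm_integral_le_of_norm_le_const (μ := Q)
      (f := fun w => h (x + w)) (C := B) (ae_of_all _ fun w => hB _)
    simpa using this
  have h0 : (∫ x, h x ∂(P.map (fun x => √(t : ℝ) • x) ∗ isoGaussian p r))
      = ∫ x, (∫ y, h (√(t : ℝ) • x + y) ∂(isoGaussian p r)) ∂P := by
    rw [integral_conv (integrable_of_continuous_of_bounded hc hB),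
      integral_map (by fun_prop) (hcont _).measurable.aestronglyMeasurable]
  have h1 : ∀ x, |(∫ y, h (√(t : ℝ) • x + y) ∂(isoGaussian p r)) - h x|
      ≤ √(r : ℝ) * (‖x‖ + gaussMeanNorm p) := by
    intro x
    have hcx : Continuous fun z => h (√(t : ℝ) • x + √(r : ℝ) • z) := by fun_prop
    rw [isoGaussian, integral_map (by fun_prop)
      (by fun_prop : Continuous fun y => h (√(t : ℝ) • x + y)).measurable.aestronglyMeasurable]
    have hx : h x = ∫ z, h x ∂(ProbabilityTheory.stdGaussian (Euc p)) := by simp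
    rw [hx, ← integral_sub (integrable_of_continuous_of_bounded hcx fun _ => hB _)
      (integrable_const _), ← Real.norm_eq_abs]
    have hint : Integrable (fun z => √(r : ℝ) * (‖x‖ + ‖z‖))
        (ProbabilityTheory.stdGaussian (Euc p)) :=
      ((integrable_const _).add integrable_norm_stdGaussian).const_mul _
    refine (norm_integral_le_of_norm_le hint (ae_of_all _ fun z => ?_)).trans (le_of_eq ?_)
    · have hd := hL.dist_le_mul (√(t : ℝ) • x + √(r : ℝ) • z) x
      rw [Real.dist_eq, dist_eq_norm, NNReal.coe_one, one_mul] at hd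
      have ht1 : √(t : ℝ) ≤ 1 := by
        exact Real.sqrt_le_one.2 (by linarith [r.coe_nonneg])
      have hr1 : √(r : ℝ) ≤ 1 := by
        exact Real.sqrt_le_one.2 (by linarith [t.coe_nonneg])
      have ht2 := Real.sq_sqrt t.coe_nonneg
      have hr2 := Real.sq_sqrt r.coe_nonneg
      have ht0 := Real.sqrt_nonneg (t : ℝ)
      have hr0 := Real.sqrt_nonneg (r : ℝ)
      have hk : 1 - √(t : ℝ) ≤ √(r : ℝ) := by nlinarith
      have he : √(t : ℝ) • x + √(r : ℝ) • z - x = √(r : ℝ) • z - (1 - √(t : ℝ)) • x := by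
        rw [sub_smul, one_smul]
        abel
      rw [he] at hd
      have hn := norm_sub_le (√(r : ℝ) • z) ((1 - √(t : ℝ)) • x)
      rw [norm_smul, norm_smul, Real.norm_of_nonneg hr0, Real.norm_of_nonneg (by linarith)] at hn
      have hk' := mul_le_mul_of_nonneg_right hk (norm_nonneg x)
      rw [Real.norm_eq_abs]
      calc _ ≤ _ := hd
        _ ≤ _ := hn
        _ ≤ _ := by linarith
    · rw [integral_const_mul, integral_add (integrable_const _) integrable_norm_stdGaussian]
      simp [gaussMeanNorm]
  rw [h0, ← integral_sub _ (integrable_of_continuous_of_bounded hc hB), ← Real.norm_eq_abs]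
  · have hint : Integrable (fun x => √(r : ℝ) * (‖x‖ + gaussMeanNorm p)) P :=
      (hP.add (integrable_const _)).const_mul _
    refine (norm_integral_le_of_norm_le hint (ae_of_all _ h1)).trans (le_of_eq ?_)
    rw [integral_const_mul, integral_add hP (integrable_const _)]
    simp
  · exact integrable_of_continuous_of_bounded ((hcont (isoGaussian p r)).comp
      (continuous_const_smul (√(t : ℝ)))) fun x => hbd _ _

lemma abs_integral_scaledSumLaw_sub_stdGaussian_le_of_bounded {h : Euc p → ℝ}
    (hL : LipschitzWith 1 h) {B : ℝ} (hB : ∀ x, |h x| ≤ B) (hν : ∀ i, ∀ᵐ x ∂(ν i), |x| ≤ 1)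
    (hm : ∀ i, ∫ x, x ∂(ν i) = 0)
    (hv : ∀ i, ∫ x, x ^ 2 ∂(ν i) = v i) (hv1 : ∀ i, v i ≤ 1)
    (hsum : ∀ u, ∑ i ∈ Finset.range n, (v i : ℝ) * ⟪a i, u⟫ ^ 2 = ‖u‖ ^ 2)
    (hP : Integrable (fun x => ‖x‖) (scaledSumLaw ν a n 1)) (m : ℕ) :
    |(∫ x, h x ∂(scaledSumLaw ν a n 1)) - ∫ x, h x ∂(ProbabilityTheory.stdGaussian (Euc p))|
      ≤ m * (2 * swapConst * ∑ i ∈ Finset.range n, ‖a i‖ ^ 3)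
        + √((1 / 2) ^ m) * ((∫ x, ‖x‖ ∂(scaledSumLaw ν a n 1)) + gaussMeanNorm p) := by
  have hr1 : ((1 / 2) ^ m : ℝ≥0) ≤ 1 := pow_le_one₀ (by positivity) (by norm_num)
  have htr : (1 - (1 / 2) ^ m : ℝ≥0) + (1 / 2) ^ m = 1 := tsub_add_cancel_of_le hr1
  have h1 := abs_integral_scaledSumLaw_dyadic_le hL hB hν hm hv hv1 hsum m rfl htr
  have h2 := abs_integral_map_smul_conv_sub_le hL hB (scaledSumLaw ν a n 1) hP htr
  rw [← scaledSumLaw_eq_map_one, abs_sub_comm] at h2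
  push_cast at h2
  refine (abs_sub_le _ _ _).trans ((add_le_add h2 h1).trans (le_of_eq ?_))
  rw [add_comm]

end Bound

lemma abs_max_neg_min_le (R s : ℝ) (hR : 0 ≤ R) :
    |max (min s R) (-R)| ≤ R := by
  rw [abs_le]
  exact ⟨le_max_right _ _, max_le (min_le_right _ _) (by linarith)⟩

lemma abs_max_neg_min_le_abs (R s : ℝ) (hR : 0 ≤ R) :
    |max (min s R) (-R)| ≤ |s| := by
  have := neg_abs_le s
  have := le_abs_self s
  have := abs_nonneg s
  rw [abs_le]
  constructor
  · rcases le_total s R with h | h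
    · rw [min_eq_left h]
      exact (neg_abs_le s).trans (le_max_left _ _)
    · rw [min_eq_right h]
      exact (by linarith : -|s| ≤ R).trans (le_max_left _ _)
  · exact max_le ((min_le_left _ _).trans (le_abs_self s)) (by linarith)

lemma integrable_of_lipschitzWith_one {f : Euc p → ℝ} (hL : LipschitzWith 1 f)
    (P : Measure (Euc p)) [IsFiniteMeasure P] (hP : Integrable (fun x => ‖x‖) P) :
    Integrable f P := by
  refine ((integrable_const |f 0|).add hP).mono' hL.continuous.measurable.aestronglyMeasurable
    (ae_of_all _ fun x => ?_)
  have := hL.dist_le_mul x 0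
  rw [Real.dist_eq, dist_zero_right, NNReal.coe_one, one_mul] at this
  simp only [Pi.add_apply, Real.norm_eq_abs]
  calc |f x| = |f 0 + (f x - f 0)| := by ring_nf
    _ ≤ _ := (abs_add_le _ _).trans (by linarith)

/-- A bound valid for bounded Lipschitz test functions is valid for all of them. -/
lemma abs_integral_sub_le_of_bounded_lipschitz (P Q : Measure (Euc p)) [IsProbabilityMeasure P]
    [IsProbabilityMeasure Q] (hP : Integrable (fun x => ‖x‖) P)
    (hQ : Integrable (fun x => ‖x‖) Q) {e : ℝ}
    (he : ∀ h : Euc p → ℝ, LipschitzWith 1 h → (∃ B, ∀ x, |h x| ≤ B) →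
      |(∫ x, h x ∂P) - ∫ x, h x ∂Q| ≤ e) {f : Euc p → ℝ} (hL : LipschitzWith 1 f) :
    |(∫ x, f x ∂P) - ∫ x, f x ∂Q| ≤ e := by
  have hfL : ∀ R : ℕ, LipschitzWith 1 fun x => max (min (f x) R) (-(R : ℝ)) := fun R =>
    (hL.min_const _).max_const _
  have key : ∀ (P : Measure (Euc p)) [IsProbabilityMeasure P], Integrable (fun x => ‖x‖) P →
      Filter.Tendsto (fun R : ℕ => ∫ x, max (min (f x) R) (-(R : ℝ)) ∂P) Filter.atTop
        (nhds (∫ x, f x ∂P)) := by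
    intro P _ hP
    refine tendsto_integral_of_dominated_convergence (fun x => |f x|)
      (fun R => (hfL R).continuous.measurable.aestronglyMeasurable)
      (integrable_of_lipschitzWith_one hL P hP).abs
      (fun R => ae_of_all _ fun x => abs_max_neg_min_le_abs _ _ R.cast_nonneg)
      (ae_of_all _ fun x => ?_)
    refine tendsto_const_nhds.congr' ?_
    obtain ⟨k, hk⟩ := exists_nat_ge |f x|
    filter_upwards [Filter.eventually_ge_atTop k] with R hR
    have hR' : |f x| ≤ R := hk.trans (by exact_mod_cast hR)
    rw [min_eq_left ((le_abs_self _).trans hR'), max_eq_left]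
    exact (neg_le_neg hR').trans (neg_abs_le _)
  exact le_of_tendsto ((key P hP).sub (key Q hQ)).abs (Filter.Eventually.of_forall fun R =>
    he _ (hfL R) ⟨R, fun x => abs_max_neg_min_le _ _ R.cast_nonneg⟩)

lemma map_sum_smul_eq_scaledSumLaw {Ω : Type*} [MeasurableSpace Ω] {μ : Measure Ω}
    [IsProbabilityMeasure μ] {η : ℕ → Ω → ℝ} (hη : ∀ i, Measurable (η i))
    (hind : iIndepFun η μ) (a : ℕ → Euc p) (n : ℕ) :
    μ.map (fun ω => ∑ i ∈ Finset.range n, η i ω • a i)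
      = scaledSumLaw (fun i => μ.map (η i)) a n 1 := by
  have hm : ∀ i, Measurable fun ω => η i ω • a i := fun i => (hη i).smul_const _
  have hind' : iIndepFun (fun i ω => η i ω • a i) μ :=
    hind.comp (fun i x => x • a i) fun i => by fun_prop
  rw [scaledSumLaw]
  induction n with
  | zero => simp [iterConv]
  | succ n ih =>
    have h1 := (hind'.indepFun_sum_range_succ hm n).map_add_eq_map_conv_map₀
      (Finset.aemeasurable_sum _ fun i _ => (hm i).aemeasurable) (hm n).aemeasurable
    have h2 : (∑ j ∈ Finset.range n, fun ω => η j ω • a j)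
        = fun ω => ∑ i ∈ Finset.range n, η i ω • a i := by
      ext ω : 1
      simp
    rw [h2, ih] at h1
    rw [iterConv]
    simp_rw [Finset.sum_range_succ]
    change _ = _ at h1
    refine h1.trans ?_
    congr 1
    rw [Measure.map_map (by fun_prop) (by fun_prop), Measure.map_map (by fun_prop) (hη n)]
    congr 1
    funext ω
    simp

lemma stdGaussian_eq : _root_.stdGaussian p = ProbabilityTheory.stdGaussian (Euc p) :=
  map_pi_eq_stdGaussian

/-- A multivariate central limit bound for Lipschitz test functions. -/
lemma abs_integral_sum_smul_sub_stdGaussian_le {Ω : Type*} [MeasurableSpace Ω] {μ : Measure Ω}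
    [IsProbabilityMeasure μ] {η : ℕ → Ω → ℝ} (hη : ∀ i, Measurable (η i))
    (hind : iIndepFun η μ) (hη1 : ∀ i ω, |η i ω| ≤ 1) (hm : ∀ i, ∫ ω, η i ω ∂μ = 0)
    {a : ℕ → Euc p} {n : ℕ}
    (hsum : ∀ u, ∑ i ∈ Finset.range n, (∫ ω, η i ω ^ 2 ∂μ) * ⟪a i, u⟫ ^ 2 = ‖u‖ ^ 2)
    {f : Euc p → ℝ} (hL : LipschitzWith 1 f) (m : ℕ) :
    |(∫ ω, f (∑ i ∈ Finset.range n, η i ω • a i) ∂μ) - ∫ x, f x ∂(_root_.stdGaussian p)|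
      ≤ m * (2 * swapConst * ∑ i ∈ Finset.range n, ‖a i‖ ^ 3)
        + √((1 / 2) ^ m)
          * ((∫ ω, ‖∑ i ∈ Finset.range n, η i ω • a i‖ ∂μ) + gaussMeanNorm p) := by
  have hW : Measurable fun ω => ∑ i ∈ Finset.range n, η i ω • a i :=
    Finset.measurable_sum _ fun i _ => (hη i).smul_const _
  have hWb : ∀ ω, ‖∑ i ∈ Finset.range n, η i ω • a i‖ ≤ ∑ i ∈ Finset.range n, ‖a i‖ := by
    refine fun ω => (norm_sum_le _ _).trans (Finset.sum_le_sum fun i _ => ?_)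
    rw [norm_smul]
    exact mul_le_of_le_one_left (norm_nonneg _) (hη1 i ω)
  have hlaw := map_sum_smul_eq_scaledSumLaw hη hind a n
  have : ∀ i, IsProbabilityMeasure (μ.map (η i)) := fun i =>
    Measure.isProbabilityMeasure_map (hη i).aemeasurable
  have hP : Integrable (fun x => ‖x‖) (scaledSumLaw (fun i => μ.map (η i)) a n 1) := by
    rw [← hlaw, integrable_map_measure (by fun_prop) hW.aemeasurable]
    exact Integrable.of_bound hW.norm.aestronglyMeasurable (∑ i ∈ Finset.range n, ‖a i‖)
      (ae_of_all _ fun ω => by simpa using hWb ω)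
  rw [stdGaussian_eq, ← integral_map hW.aemeasurable hL.continuous.measurable.aestronglyMeasurable,
    ← integral_map (φ := fun ω => ∑ i ∈ Finset.range n, η i ω • a i) (f := fun x => ‖x‖)
      hW.aemeasurable (by fun_prop), hlaw]
  refine abs_integral_sub_le_of_bounded_lipschitz _ _ hP integrable_norm_stdGaussian ?_ hL
  rintro h hhL ⟨B, hB⟩
  have hsq : ∀ i, ∫ ω, η i ω ^ 2 ∂μ ≤ 1 := fun i => by
    have := norm_integral_le_of_norm_le_const (μ := μ) (f := fun ω => η i ω ^ 2) (C := 1)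
      (ae_of_all _ fun ω => by
        rw [Real.norm_eq_abs, abs_pow]
        exact pow_le_one₀ (abs_nonneg _) (hη1 i ω))
    simp only [probReal_univ, mul_one] at this
    exact (le_abs_self _).trans this
  refine abs_integral_scaledSumLaw_sub_stdGaussian_le_of_bounded
    (v := fun i => (⟨∫ ω, η i ω ^ 2 ∂μ, integral_nonneg fun ω => sq_nonneg _⟩ : ℝ≥0)) hhL hB
    (fun i => ?_) (fun i => ?_) (fun i => ?_) (fun i => ?_) hsum hP m
  · rw [ae_map_iff (hη i).aemeasurable (measurableSet_le (by fun_prop) (by fun_prop))]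
    exact ae_of_all _ (hη1 i)
  · rw [integral_map (hη i).aemeasurable (by fun_prop), hm]
  · rw [integral_map (hη i).aemeasurable (by fun_prop)]
    rfl
  · exact_mod_cast hsq i

lemma sigmoid_eq_exp_div (z : ℝ) : Real.sigmoid z = Real.exp z / (1 + Real.exp z) := by
  rw [Real.sigmoid_def, Real.exp_neg]
  have := Real.exp_pos z
  field_simp
  ring

lemma hasDerivAt_log_one_add_exp (z : ℝ) :
    HasDerivAt (fun z => Real.log (1 + Real.exp z)) (Real.sigmoid z) z := by
  rw [sigmoid_eq_exp_div]
  exact ((Real.hasDerivAt_exp z).const_add 1).log (by positivity)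

lemma hasDerivAt_sigmoid_mul (z : ℝ) :
    HasDerivAt (fun z => Real.sigmoid z * (1 - Real.sigmoid z))
      (Real.sigmoid z * (1 - Real.sigmoid z) * (1 - 2 * Real.sigmoid z)) z := by
  have h := Real.hasDerivAt_sigmoid z
  exact (h.fun_mul (h.const_sub 1)).congr_deriv (by ring)

lemma sigmoid_mul_nonneg (z : ℝ) : 0 ≤ Real.sigmoid z * (1 - Real.sigmoid z) :=
  mul_nonneg (Real.sigmoid_nonneg z) (by linarith [Real.sigmoid_le_one z])

lemma sigmoid_mul_le_one (z : ℝ) : Real.sigmoid z * (1 - Real.sigmoid z) ≤ 1 := by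
  have := Real.sigmoid_nonneg z
  have := Real.sigmoid_le_one z
  nlinarith

lemma le_sigmoid_mul {R z : ℝ} (hz : |z| ≤ R) :
    Real.sigmoid (-R) ^ 2 ≤ Real.sigmoid z * (1 - Real.sigmoid z) := by
  rw [← Real.sigmoid_neg, sq]
  have hz' := abs_le.1 hz
  exact mul_le_mul (Real.sigmoid_le hz'.1) (Real.sigmoid_le (by linarith)) (Real.sigmoid_nonneg _)
    (Real.sigmoid_nonneg _)

lemma abs_sigmoid_taylor_le (a b : ℝ) :
    |Real.sigmoid b - Real.sigmoid a - (Real.sigmoid a * (1 - Real.sigmoid a)) * (b - a)|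
      ≤ (b - a) ^ 2 := by
  have h := taylor_one_of_lipschitz (L := 1) zero_le_one Real.hasDerivAt_sigmoid (fun x y => ?_) a
    (b - a)
  · rw [add_sub_cancel, one_mul, sq_abs] at h
    rwa [mul_comm (b - a)] at h
  · have := convex_univ.norm_image_sub_le_of_norm_hasDerivWithin_le (C := 1) (s := univ)
      (f := fun z => Real.sigmoid z * (1 - Real.sigmoid z))
      (fun z _ => (hasDerivAt_sigmoid_mul z).hasDerivWithinAt) (fun z _ => ?_) (mem_univ y)
      (mem_univ x)
    · exact this
    · have h0 := Real.sigmoid_nonneg z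
      have h1 := Real.sigmoid_le_one z
      rw [norm_mul, Real.norm_of_nonneg (sigmoid_mul_nonneg z), Real.norm_eq_abs]
      refine mul_le_one₀ (sigmoid_mul_le_one z) (abs_nonneg _) ?_
      rw [abs_le]
      constructor <;> linarith

/-- Strong convexity of the logistic loss on bounded intervals. -/
lemma log_one_add_exp_quadratic_le {R a b : ℝ} (ha : |a| ≤ R) (hb : |b| ≤ R) :
    Real.log (1 + Real.exp a) + Real.sigmoid a * (b - a) + Real.sigmoid (-R) ^ 2 / 2 * (b - a) ^ 2
      ≤ Real.log (1 + Real.exp b) := by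
  set k := Real.sigmoid (-R) ^ 2 with hk
  have ha' := abs_le.1 ha
  have hb' := abs_le.1 hb
  have hd1 : ∀ t, HasDerivAt (fun t => Real.sigmoid t - k * t)
      (Real.sigmoid t * (1 - Real.sigmoid t) - k) t := fun t =>
    ((Real.hasDerivAt_sigmoid t).fun_sub ((hasDerivAt_id t).const_mul k)).congr_deriv (by simp)
  have hmono : MonotoneOn (fun t => Real.sigmoid t - k * t) (Icc (-R) R) := by
    refine monotoneOn_of_deriv_nonneg (convex_Icc _ _)
      (fun t _ => (hd1 t).continuousAt.continuousWithinAt)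
      (fun t _ => (hd1 t).differentiableAt.differentiableWithinAt) fun t ht => ?_
    rw [(hd1 t).deriv, sub_nonneg]
    rw [interior_Icc] at ht
    exact le_sigmoid_mul (abs_le.2 ⟨ht.1.le, ht.2.le⟩)
  have hd2 : ∀ t, HasDerivAt
      (fun t => Real.log (1 + Real.exp t) - Real.sigmoid a * (t - a) - k / 2 * (t - a) ^ 2)
      ((Real.sigmoid t - k * t) - (Real.sigmoid a - k * a)) t := fun t => by
    have h1 := (hasDerivAt_id t).sub_const a
    exact (((hasDerivAt_log_one_add_exp t).fun_sub (h1.const_mul _)).fun_sub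
      ((h1.fun_pow 2).const_mul (k / 2))).congr_deriv (by simp; ring)
  rcases le_total a b with hab | hab
  · have : MonotoneOn
        (fun t => Real.log (1 + Real.exp t) - Real.sigmoid a * (t - a) - k / 2 * (t - a) ^ 2)
        (Icc a b) := by
      refine monotoneOn_of_deriv_nonneg (convex_Icc _ _)
        (fun t _ => (hd2 t).continuousAt.continuousWithinAt)
        (fun t _ => (hd2 t).differentiableAt.differentiableWithinAt) fun t ht => ?_
      rw [(hd2 t).deriv, sub_nonneg]
      rw [interior_Icc] at ht
      exact hmono ⟨ha'.1, ha'.2⟩ ⟨by linarith [ht.1], by linarith [ht.2]⟩ ht.1.le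
    have := this (left_mem_Icc.2 hab) (right_mem_Icc.2 hab) hab
    simp only [sub_self, mul_zero, sub_zero, zero_pow two_ne_zero] at this
    linarith
  · have : AntitoneOn
        (fun t => Real.log (1 + Real.exp t) - Real.sigmoid a * (t - a) - k / 2 * (t - a) ^ 2)
        (Icc b a) := by
      refine antitoneOn_of_deriv_nonpos (convex_Icc _ _)
        (fun t _ => (hd2 t).continuousAt.continuousWithinAt)
        (fun t _ => (hd2 t).differentiableAt.differentiableWithinAt) fun t ht => ?_
      rw [(hd2 t).deriv, sub_nonpos]
      rw [interior_Icc] at ht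
      exact hmono ⟨by linarith [ht.1], by linarith [ht.2]⟩ ⟨ha'.1, ha'.2⟩ ht.2.le
    have := this (left_mem_Icc.2 hab) (right_mem_Icc.2 hab) hab
    simp only [sub_self, mul_zero, sub_zero, zero_pow two_ne_zero] at this
    linarith

/-- The normalized negative log-likelihood of logistic regression with responses `c`. -/
def logisticRisk (x : ℕ → Euc p) (c : ℕ → ℝ) (n : ℕ) (θ : Euc p) : ℝ :=
  (1 / n) * ∑ i ∈ Finset.range n, (-(c i) * ⟪x i, θ⟫ + Real.log (1 + Real.exp ⟪x i, θ⟫))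

/-- The gradient of `logisticRisk`. -/
def logisticScore (x : ℕ → Euc p) (c : ℕ → ℝ) (n : ℕ) (θ : Euc p) : Euc p :=
  (1 / n : ℝ) • ∑ i ∈ Finset.range n, (Real.sigmoid ⟪x i, θ⟫ - c i) • x i

/-- The Hessian of `logisticRisk`, as a map. -/
def logisticHess (x : ℕ → Euc p) (n : ℕ) (θ v : Euc p) : Euc p :=
  (1 / n : ℝ) • ∑ i ∈ Finset.range n,
    (Real.sigmoid ⟪x i, θ⟫ * (1 - Real.sigmoid ⟪x i, θ⟫) * ⟪x i, v⟫) • x i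

lemma hasFDerivAt_logisticRisk (x : ℕ → Euc p) (c : ℕ → ℝ) (n : ℕ) (θ : Euc p) :
    HasFDerivAt (logisticRisk x c n) (innerSL ℝ (logisticScore x c n θ)) θ := by
  have h1 : ∀ i, HasFDerivAt (fun θ : Euc p => ⟪x i, θ⟫) (innerSL ℝ (x i)) θ := fun i =>
    (innerSL ℝ (x i)).hasFDerivAt
  have h2 : ∀ i, HasFDerivAt
      (fun θ : Euc p => -(c i) * ⟪x i, θ⟫ + Real.log (1 + Real.exp ⟪x i, θ⟫))
      ((-(c i)) • innerSL ℝ (x i) + Real.sigmoid ⟪x i, θ⟫ • innerSL ℝ (x i)) θ := fun i =>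
    ((h1 i).const_mul _).add
      ((hasDerivAt_log_one_add_exp ⟪x i, θ⟫).comp_hasFDerivAt θ (h1 i))
  have h3 := (HasFDerivAt.fun_sum (u := Finset.range n) fun i _ => h2 i).const_mul (1 / n : ℝ)
  refine h3.congr_fderiv ?_
  ext v
  simp only [logisticScore, map_smul, map_sum]
  simp [add_comm, sub_eq_add_neg, Finset.mul_sum, add_mul]

lemma hasFDerivAt_logisticScore_apply (x : ℕ → Euc p) (c : ℕ → ℝ) (n : ℕ) (j : Fin p)
    (θ : Euc p) :
    HasFDerivAt (fun θ => logisticScore x c n θ j)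
      ((1 / n : ℝ) • ∑ i ∈ Finset.range n, (x i j *
        (Real.sigmoid ⟪x i, θ⟫ * (1 - Real.sigmoid ⟪x i, θ⟫))) • innerSL ℝ (x i)) θ := by
  have h1 : ∀ i, HasFDerivAt (fun θ : Euc p => ⟪x i, θ⟫) (innerSL ℝ (x i)) θ := fun i =>
    (innerSL ℝ (x i)).hasFDerivAt
  have h2 : ∀ i, HasFDerivAt (fun θ : Euc p => (Real.sigmoid ⟪x i, θ⟫ - c i) * x i j)
      ((x i j * (Real.sigmoid ⟪x i, θ⟫ * (1 - Real.sigmoid ⟪x i, θ⟫))) • innerSL ℝ (x i)) θ :=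
    fun i => by
    have := (((Real.hasDerivAt_sigmoid ⟪x i, θ⟫).comp_hasFDerivAt θ (h1 i)).sub_const
      (c i)).mul_const (x i j)
    rw [smul_smul] at this
    exact this
  have h3 := (HasFDerivAt.fun_sum (u := Finset.range n) fun i _ => h2 i).const_mul (1 / n : ℝ)
  refine h3.congr_of_eventuallyEq (Filter.Eventually.of_forall fun θ => ?_)
  simp [logisticScore]

lemma pder_logisticRisk (x : ℕ → Euc p) (c : ℕ → ℝ) (n : ℕ) (j : Fin p) (θ : Euc p) :
    pder j (logisticRisk x c n) θ = logisticScore x c n θ j := by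
  rw [pder, (hasFDerivAt_logisticRisk x c n θ).fderiv, innerSL_apply_apply, EuclideanSpace.inner_single_right]
  simp

lemma pder_pder_logisticRisk (x : ℕ → Euc p) (c : ℕ → ℝ) (n : ℕ) (j k : Fin p) (θ : Euc p) :
    pder k (pder j (logisticRisk x c n)) θ = (1 / n) * ∑ i ∈ Finset.range n,
      (Real.sigmoid ⟪x i, θ⟫ * (1 - Real.sigmoid ⟪x i, θ⟫)) * (x i j * x i k) := by
  have : pder j (logisticRisk x c n) = fun θ => logisticScore x c n θ j :=
    funext fun θ => pder_logisticRisk x c n j θ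
  rw [this, pder, (hasFDerivAt_logisticScore_apply x c n j θ).fderiv]
  simp only [smul_apply, sum_apply, smul_eq_mul,
    innerSL_apply_apply]
  congr 1
  refine Finset.sum_congr rfl fun i _ => ?_
  rw [EuclideanSpace.inner_single_right]
  simp
  ring

section Deterministic

variable {x : ℕ → Euc p} {c : ℕ → ℝ} {n : ℕ} {Cx D lam : ℝ} {θ θ0 : Euc p}

lemma abs_inner_le_of_norm_le (hx : ∀ i, ‖x i‖ ≤ Cx) (hθ : ‖θ‖ ≤ D) (i : ℕ) :
    |⟪x i, θ⟫| ≤ Cx * D :=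
  (abs_real_inner_le_norm _ _).trans
    (mul_le_mul (hx i) hθ (norm_nonneg _) ((norm_nonneg _).trans (hx i)))

lemma logisticRisk_quadratic_le (hx : ∀ i, ‖x i‖ ≤ Cx) (hθ : ‖θ‖ ≤ D) (hθ0 : ‖θ0‖ ≤ D)
    (hdes : ∀ v, lam * ‖v‖ ^ 2 ≤ (1 / n) * ∑ i ∈ Finset.range n, ⟪x i, v⟫ ^ 2) :
    logisticRisk x c n θ0 + ⟪logisticScore x c n θ0, θ - θ0⟫
      + Real.sigmoid (-(Cx * D)) ^ 2 / 2 * (lam * ‖θ - θ0‖ ^ 2) ≤ logisticRisk x c n θ := by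
  have hk : 0 ≤ Real.sigmoid (-(Cx * D)) ^ 2 / 2 := by positivity
  calc _ ≤ logisticRisk x c n θ0 + ⟪logisticScore x c n θ0, θ - θ0⟫
      + Real.sigmoid (-(Cx * D)) ^ 2 / 2
        * ((1 / n) * ∑ i ∈ Finset.range n, ⟪x i, θ - θ0⟫ ^ 2) := by
        exact add_le_add le_rfl (mul_le_mul_of_nonneg_left (hdes _) hk)
    _ = (1 / n) * ∑ i ∈ Finset.range n, ((-(c i) * ⟪x i, θ⟫)
        + (Real.log (1 + Real.exp ⟪x i, θ0⟫) + Real.sigmoid ⟪x i, θ0⟫ * (⟪x i, θ⟫ - ⟪x i, θ0⟫)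
          + Real.sigmoid (-(Cx * D)) ^ 2 / 2 * (⟪x i, θ⟫ - ⟪x i, θ0⟫) ^ 2)) := by
        rw [logisticRisk, logisticScore, real_inner_smul_left, sum_inner, mul_left_comm, ← mul_add,
          ← mul_add, Finset.mul_sum, ← Finset.sum_add_distrib, ← Finset.sum_add_distrib]
        congr 1
        refine Finset.sum_congr rfl fun i _ => ?_
        rw [real_inner_smul_left, inner_sub_right]
        ring
    _ ≤ _ := by
        rw [logisticRisk]
        gcongr with i _
        exact log_one_add_exp_quadratic_le (abs_inner_le_of_norm_le hx hθ0 i)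
          (abs_inner_le_of_norm_le hx hθ i)

lemma norm_sub_le_of_logisticRisk_le (hx : ∀ i, ‖x i‖ ≤ Cx) (hθ : ‖θ‖ ≤ D) (hθ0 : ‖θ0‖ ≤ D)
    (hlam : 0 < lam)
    (hdes : ∀ v, lam * ‖v‖ ^ 2 ≤ (1 / n) * ∑ i ∈ Finset.range n, ⟪x i, v⟫ ^ 2)
    (hle : logisticRisk x c n θ ≤ logisticRisk x c n θ0) :
    ‖θ - θ0‖ ≤ 2 / (Real.sigmoid (-(Cx * D)) ^ 2 * lam) * ‖logisticScore x c n θ0‖ := by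
  have h := logisticRisk_quadratic_le (c := c) hx hθ hθ0 hdes
  have h2 := neg_le_of_abs_le (abs_real_inner_le_norm (logisticScore x c n θ0) (θ - θ0))
  have hk := Real.sigmoid_pos (-(Cx * D))
  set k := Real.sigmoid (-(Cx * D)) ^ 2 * lam with hkdef
  have hk0 : 0 < k := by positivity
  have h3 : k / 2 * ‖θ - θ0‖ ^ 2 ≤ ‖logisticScore x c n θ0‖ * ‖θ - θ0‖ := by
    rw [hkdef]
    linarith
  rcases (norm_nonneg (θ - θ0)).eq_or_lt with h0 | h0
  · rw [← h0]
    positivity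
  · have h4 : k / 2 * ‖θ - θ0‖ ≤ ‖logisticScore x c n θ0‖ := by
      refine le_of_mul_le_mul_right ?_ h0
      linarith
    rw [div_mul_eq_mul_div, le_div_iff₀ hk0]
    linarith

lemma norm_average_smul_le (hx : ∀ i, ‖x i‖ ≤ Cx) {w : ℕ → ℝ} {b : ℝ} (hb : 0 ≤ b)
    (hw : ∀ i, |w i| ≤ b) :
    ‖(1 / n : ℝ) • ∑ i ∈ Finset.range n, w i • x i‖ ≤ b * Cx := by
  have hCx : 0 ≤ Cx := (norm_nonneg _).trans (hx 0)
  have h1 : ‖∑ i ∈ Finset.range n, w i • x i‖ ≤ n * (b * Cx) := by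
    refine (norm_sum_le_of_le _ (f := fun i => w i • x i) (n := fun _ => b * Cx)
      fun i _ => ?_).trans (by simp)
    rw [norm_smul, Real.norm_eq_abs]
    exact mul_le_mul (hw i) (hx i) (norm_nonneg _) hb
  rw [norm_smul, Real.norm_of_nonneg (by positivity)]
  rcases n.eq_zero_or_pos with rfl | hn
  · simp
    positivity
  · have hn' : (0 : ℝ) < n := by exact_mod_cast hn
    rw [one_div, inv_mul_le_iff₀ hn']
    exact h1

lemma norm_logisticScore_taylor_le (hx : ∀ i, ‖x i‖ ≤ Cx) :
    ‖logisticScore x c n θ - logisticScore x c n θ0 - logisticHess x n θ0 (θ - θ0)‖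
      ≤ Cx ^ 3 * ‖θ - θ0‖ ^ 2 := by
  have hCx : 0 ≤ Cx := (norm_nonneg _).trans (hx 0)
  have : logisticScore x c n θ - logisticScore x c n θ0 - logisticHess x n θ0 (θ - θ0)
      = (1 / n : ℝ) • ∑ i ∈ Finset.range n, (Real.sigmoid ⟪x i, θ⟫ - Real.sigmoid ⟪x i, θ0⟫
        - (Real.sigmoid ⟪x i, θ0⟫ * (1 - Real.sigmoid ⟪x i, θ0⟫)) * (⟪x i, θ⟫ - ⟪x i, θ0⟫))
        • x i := by
    rw [logisticScore, logisticScore, logisticHess, ← smul_sub, ← smul_sub,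
      ← Finset.sum_sub_distrib, ← Finset.sum_sub_distrib]
    congr 1
    refine Finset.sum_congr rfl fun i _ => ?_
    rw [← sub_smul, ← sub_smul, inner_sub_right]
    congr 1
    ring
  rw [this]
  refine (norm_average_smul_le hx (b := Cx ^ 2 * ‖θ - θ0‖ ^ 2) (by positivity)
    fun i => ?_).trans (le_of_eq (by ring))
  refine (abs_sigmoid_taylor_le _ _).trans ?_
  rw [← inner_sub_right, ← sq_abs, ← mul_pow]
  gcongr
  exact abs_inner_le_of_norm_le hx le_rfl i

lemma norm_logisticScore_le (hx : ∀ i, ‖x i‖ ≤ Cx) (hc : ∀ i, c i = 0 ∨ c i = 1) :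
    ‖logisticScore x c n θ‖ ≤ Cx := by
  refine (norm_average_smul_le hx zero_le_one fun i => ?_).trans (one_mul _).le
  have h0 := Real.sigmoid_nonneg ⟪x i, θ⟫
  have h1 := Real.sigmoid_le_one ⟪x i, θ⟫
  rw [abs_le]
  rcases hc i with h | h <;> rw [h] <;> constructor <;> linarith

lemma norm_logisticHess_le (hx : ∀ i, ‖x i‖ ≤ Cx) (v : Euc p) :
    ‖logisticHess x n θ v‖ ≤ Cx ^ 2 * ‖v‖ := by
  have hCx : 0 ≤ Cx := (norm_nonneg _).trans (hx 0)
  refine (norm_average_smul_le hx (b := Cx * ‖v‖) (by positivity) fun i => ?_).trans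
    (le_of_eq (by ring))
  rw [abs_mul, abs_of_nonneg (sigmoid_mul_nonneg _)]
  exact (mul_le_of_le_one_left (abs_nonneg _) (sigmoid_mul_le_one _)).trans
    (abs_inner_le_of_norm_le hx le_rfl i)

/-- The linearized score equation holds at a constrained minimizer up to a quadratic error. -/
lemma norm_logisticScore_add_hess_le {Θ : Set (Euc p)} (hx : ∀ i, ‖x i‖ ≤ Cx)
    (hc : ∀ i, c i = 0 ∨ c i = 1) {r : ℝ} (hr : 0 < r) (hball : Metric.ball θ0 r ⊆ Θ)
    (hmin : ∀ θ' ∈ Θ, logisticRisk x c n θ ≤ logisticRisk x c n θ') :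
    ‖logisticScore x c n θ0 + logisticHess x n θ0 (θ - θ0)‖
      ≤ (Cx ^ 3 + Cx / r ^ 2 + Cx ^ 2 / r) * ‖θ - θ0‖ ^ 2 := by
  have hCx : 0 ≤ Cx := (norm_nonneg _).trans (hx 0)
  rcases lt_or_ge ‖θ - θ0‖ r with h | h
  · have hmem : θ ∈ Metric.ball θ0 r := by
      rwa [Metric.mem_ball, dist_eq_norm]
    have hloc : IsLocalMin (logisticRisk x c n) θ := by
      filter_upwards [Metric.isOpen_ball.mem_nhds hmem] with θ' hθ'
      exact hmin θ' (hball hθ')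
    have h0 : logisticScore x c n θ = 0 := by
      have h1 := hloc.hasFDerivAt_eq_zero (hasFDerivAt_logisticRisk x c n θ)
      have h2 : innerSL ℝ (logisticScore x c n θ) (logisticScore x c n θ) = 0 := by
        rw [h1]
        rfl
      rw [innerSL_apply_apply] at h2
      exact inner_self_eq_zero.1 h2
    have h3 := norm_logisticScore_taylor_le (c := c) (n := n) (θ := θ) (θ0 := θ0) hx
    rw [h0, zero_sub, ← neg_add', norm_neg] at h3
    refine h3.trans ?_
    gcongr
    have : 0 ≤ Cx / r ^ 2 := by positivity
    have : 0 ≤ Cx ^ 2 / r := by positivity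
    linarith
  · have h1 := norm_logisticScore_le (n := n) (θ := θ0) hx hc
    have h2 := norm_logisticHess_le (n := n) (θ := θ0) hx (θ - θ0)
    have h3 : Cx ≤ Cx / r ^ 2 * ‖θ - θ0‖ ^ 2 := by
      rw [div_mul_eq_mul_div, le_div_iff₀ (by positivity)]
      gcongr
    have h4 : Cx ^ 2 * ‖θ - θ0‖ ≤ Cx ^ 2 / r * ‖θ - θ0‖ ^ 2 := by
      rw [div_mul_eq_mul_div, le_div_iff₀ hr, sq ‖θ - θ0‖, ← mul_assoc]
      gcongr
    have h5 : 0 ≤ Cx ^ 3 * ‖θ - θ0‖ ^ 2 := by positivity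
    refine (norm_add_le _ _).trans ?_
    linarith

end Deterministic

lemma inner_logisticHess_self (x : ℕ → Euc p) (n : ℕ) (θ v : Euc p) :
    ⟪logisticHess x n θ v, v⟫ = (1 / n) * ∑ i ∈ Finset.range n,
      (Real.sigmoid ⟪x i, θ⟫ * (1 - Real.sigmoid ⟪x i, θ⟫)) * ⟪x i, v⟫ ^ 2 := by
  rw [logisticHess, real_inner_smul_left, sum_inner]
  congr 1
  refine Finset.sum_congr rfl fun i _ => ?_
  rw [real_inner_smul_left]
  ring

lemma le_inner_logisticHess_self {x : ℕ → Euc p} {n : ℕ} {Cx D lam : ℝ} {θ : Euc p}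
    (hx : ∀ i, ‖x i‖ ≤ Cx) (hθ : ‖θ‖ ≤ D)
    (hdes : ∀ v, lam * ‖v‖ ^ 2 ≤ (1 / n) * ∑ i ∈ Finset.range n, ⟪x i, v⟫ ^ 2) (v : Euc p) :
    Real.sigmoid (-(Cx * D)) ^ 2 * lam * ‖v‖ ^ 2 ≤ ⟪logisticHess x n θ v, v⟫ := by
  rw [inner_logisticHess_self, mul_assoc]
  refine (mul_le_mul_of_nonneg_left (hdes v) (sq_nonneg _)).trans ?_
  rw [mul_left_comm, Finset.mul_sum]
  gcongr with i _
  exact le_sigmoid_mul (abs_inner_le_of_norm_le hx hθ i)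

section InverseSqrt

variable {L : Euc p →ₗ[ℝ] Euc p} {H : Euc p → Euc p}

lemma map_hess_map_eq (hLH : ∀ v, L (L (H v)) = v) (u : Euc p) : L (H (L u)) = u := by
  have hsurj : Function.Surjective L := fun v => ⟨_, hLH v⟩
  exact (LinearMap.injective_iff_surjective.2 hsurj) (hLH (L u))

lemma inner_hess_map_self (hL : L.IsSymmetric) (hLH : ∀ v, L (L (H v)) = v) (u : Euc p) :
    ⟪H (L u), L u⟫ = ‖u‖ ^ 2 := by
  rw [← hL, map_hess_map_eq hLH, real_inner_self_eq_norm_sq]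

lemma norm_inverseSqrt_le (hL : L.IsSymmetric) (hLH : ∀ v, L (L (H v)) = v) {k : ℝ} (hk : 0 < k)
    (hH : ∀ v, k * ‖v‖ ^ 2 ≤ ⟪H v, v⟫) (u : Euc p) : ‖L u‖ ≤ (√k)⁻¹ * ‖u‖ := by
  have h := hH (L u)
  rw [inner_hess_map_self hL hLH] at h
  rw [le_inv_mul_iff₀ (Real.sqrt_pos.2 hk)]
  refine abs_le_of_sq_le_sq' ?_ (norm_nonneg _) |>.2
  rwa [mul_pow, Real.sq_sqrt hk.le]

end InverseSqrt

section Probability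

variable {Ω : Type*} [MeasurableSpace Ω] {μ : Measure Ω} [IsProbabilityMeasure μ]
  {η : ℕ → Ω → ℝ}

lemma integral_sum_mul_sum_eq (hη : ∀ i, Measurable (η i)) (hind : iIndepFun η μ)
    (hη1 : ∀ i ω, |η i ω| ≤ 1) (hm : ∀ i, ∫ ω, η i ω ∂μ = 0) (b c : ℕ → ℝ) (n : ℕ) :
    ∫ ω, (∑ i ∈ Finset.range n, η i ω * b i) * (∑ i ∈ Finset.range n, η i ω * c i) ∂μ
      = ∑ i ∈ Finset.range n, (∫ ω, η i ω ^ 2 ∂μ) * (b i * c i) := by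
  have hint : ∀ i j, Integrable (fun ω => η i ω * b i * (η j ω * c j)) μ := fun i j => by
    refine Integrable.of_bound (C := |b i| * |c j|)
      (((hη i).mul_const _).mul ((hη j).mul_const _)).aestronglyMeasurable
      (ae_of_all _ fun ω => ?_)
    rw [Real.norm_eq_abs, abs_mul, abs_mul, abs_mul]
    exact mul_le_mul (mul_le_of_le_one_left (abs_nonneg _) (hη1 i ω))
      (mul_le_of_le_one_left (abs_nonneg _) (hη1 j ω)) (by positivity) (abs_nonneg _)
  simp_rw [Finset.sum_mul_sum]
  rw [integral_finsetSum _ fun i _ => integrable_finsetSum _ fun j _ => hint i j]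
  refine Finset.sum_congr rfl fun i hi => ?_
  rw [integral_finsetSum _ fun j _ => hint i j, Finset.sum_eq_single_of_mem i hi fun j _ hj => ?_]
  · rw [← integral_mul_const]
    congr 1
    funext ω
    ring
  · have h1 : ∫ ω, η i ω * η j ω ∂μ = 0 := by
      rw [(hind.indepFun hj.symm).integral_fun_mul_eq_mul_integral
        (hη i).aestronglyMeasurable (hη j).aestronglyMeasurable, hm, zero_mul]
    calc _ = ∫ ω, η i ω * η j ω * (b i * c j) ∂μ := by
          congr 1
          funext ω
          ring
      _ = 0 := by rw [integral_mul_const, h1, zero_mul]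

lemma integral_norm_sum_smul_sq_eq (hη : ∀ i, Measurable (η i)) (hind : iIndepFun η μ)
    (hη1 : ∀ i ω, |η i ω| ≤ 1) (hm : ∀ i, ∫ ω, η i ω ∂μ = 0) (a : ℕ → Euc p) (n : ℕ) :
    ∫ ω, ‖∑ i ∈ Finset.range n, η i ω • a i‖ ^ 2 ∂μ
      = ∑ i ∈ Finset.range n, (∫ ω, η i ω ^ 2 ∂μ) * ‖a i‖ ^ 2 := by
  have h1 : ∀ ω, ‖∑ i ∈ Finset.range n, η i ω • a i‖ ^ 2
      = ∑ j, (∑ i ∈ Finset.range n, η i ω * a i j) * (∑ i ∈ Finset.range n, η i ω * a i j) :=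
    fun ω => by
    rw [EuclideanSpace.real_norm_sq_eq]
    refine Finset.sum_congr rfl fun j _ => ?_
    simp [sq]
  have hint : ∀ j, Integrable (fun ω => (∑ i ∈ Finset.range n, η i ω * a i j)
      * (∑ i ∈ Finset.range n, η i ω * a i j)) μ := fun j => by
    have hms : Measurable fun ω => ∑ i ∈ Finset.range n, η i ω * a i j :=
      Finset.measurable_sum _ fun i _ => (hη i).mul_const _
    have hb : ∀ ω, |∑ i ∈ Finset.range n, η i ω * a i j| ≤ ∑ i ∈ Finset.range n, |a i j| :=
      fun ω => by
      refine (Finset.abs_sum_le_sum_abs _ _).trans (Finset.sum_le_sum fun i _ => ?_)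
      rw [abs_mul]
      exact mul_le_of_le_one_left (abs_nonneg _) (hη1 i ω)
    refine Integrable.of_bound (C := (∑ i ∈ Finset.range n, |a i j|)
      * (∑ i ∈ Finset.range n, |a i j|)) (hms.mul hms).aestronglyMeasurable
      (ae_of_all _ fun ω => ?_)
    rw [Real.norm_eq_abs, abs_mul]
    exact mul_le_mul (hb ω) (hb ω) (abs_nonneg _) ((abs_nonneg _).trans (hb ω))
  simp_rw [h1]
  rw [integral_finsetSum _ fun j _ => hint j]
  simp_rw [integral_sum_mul_sum_eq hη hind hη1 hm]
  rw [Finset.sum_comm]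
  refine Finset.sum_congr rfl fun i _ => ?_
  rw [EuclideanSpace.real_norm_sq_eq, Finset.mul_sum]
  simp [sq]

lemma integral_sq_le_one (hη1 : ∀ i ω, |η i ω| ≤ 1) (i : ℕ) : ∫ ω, η i ω ^ 2 ∂μ ≤ 1 := by
  have := norm_integral_le_of_norm_le_const (μ := μ) (f := fun ω => η i ω ^ 2) (C := 1)
    (ae_of_all _ fun ω => by
      rw [Real.norm_eq_abs, abs_pow]
      exact pow_le_one₀ (abs_nonneg _) (hη1 i ω))
  simp only [probReal_univ, mul_one] at this
  exact (le_abs_self _).trans this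

lemma integral_norm_sum_smul_sq_le (hη : ∀ i, Measurable (η i)) (hind : iIndepFun η μ)
    (hη1 : ∀ i ω, |η i ω| ≤ 1) (hm : ∀ i, ∫ ω, η i ω ∂μ = 0) {a : ℕ → Euc p} {b : ℝ}
    (ha : ∀ i, ‖a i‖ ≤ b) (n : ℕ) :
    ∫ ω, ‖∑ i ∈ Finset.range n, η i ω • a i‖ ^ 2 ∂μ ≤ n * b ^ 2 := by
  rw [integral_norm_sum_smul_sq_eq hη hind hη1 hm]
  calc _ ≤ ∑ i ∈ Finset.range n, b ^ 2 := by
        refine Finset.sum_le_sum fun i _ => ?_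
        exact (mul_le_of_le_one_left (sq_nonneg _) (integral_sq_le_one hη1 i)).trans
          (pow_le_pow_left₀ (norm_nonneg _) (ha i) 2)
    _ = _ := by simp

lemma integrable_norm_sum_smul_pow (hη : ∀ i, Measurable (η i))
    (hη1 : ∀ i ω, |η i ω| ≤ 1) (a : ℕ → Euc p) (n k : ℕ) :
    Integrable (fun ω => ‖∑ i ∈ Finset.range n, η i ω • a i‖ ^ k) μ := by
  have hW : Measurable fun ω => ∑ i ∈ Finset.range n, η i ω • a i :=
    Finset.measurable_sum _ fun i _ => (hη i).smul_const _
  refine Integrable.of_bound (hW.norm.pow_const k).aestronglyMeasurable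
    ((∑ i ∈ Finset.range n, ‖a i‖) ^ k) (ae_of_all _ fun ω => ?_)
  rw [norm_pow, norm_norm]
  gcongr
  refine (norm_sum_le _ _).trans (Finset.sum_le_sum fun i _ => ?_)
  rw [norm_smul]
  exact mul_le_of_le_one_left (norm_nonneg _) (hη1 i ω)

lemma one_le_log_of_three_le {n : ℕ} (hn : 3 ≤ n) : 1 ≤ Real.log n := by
  have h3 : (3 : ℝ) ≤ n := by exact_mod_cast hn
  rw [Real.le_log_iff_exp_le (by linarith)]
  linarith [Real.exp_one_lt_d9]

lemma natLog_two_add_one_le {n : ℕ} (hn : 3 ≤ n) :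
    ((Nat.log 2 n + 1 : ℕ) : ℝ) ≤ 3 * Real.log n := by
  have h1 := one_le_log_of_three_le hn
  have h2 : ((2 : ℝ) ^ Nat.log 2 n) ≤ n := by exact_mod_cast Nat.pow_log_le_self 2 (by omega)
  have h3 := Real.log_le_log (by positivity) h2
  rw [Real.log_pow] at h3
  have h4 := Real.log_two_gt_d9
  have h5 : (0 : ℝ) ≤ Nat.log 2 n := by positivity
  push_cast
  nlinarith

lemma sqrt_half_pow_natLog_le {n : ℕ} (hn : 0 < n) :
    √((1 / 2) ^ (Nat.log 2 n + 1)) ≤ 1 / √n := by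
  have hn' : (0 : ℝ) < n := by exact_mod_cast hn
  have h : (n : ℝ) ≤ 2 ^ (Nat.log 2 n + 1) := by
    exact_mod_cast (Nat.lt_pow_succ_log_self (by norm_num) n).le
  rw [one_div_pow, Real.sqrt_div zero_le_one, Real.sqrt_one]
  gcongr

lemma abs_integral_sum_smul_sub_stdGaussian_le_log (hη : ∀ i, Measurable (η i))
    (hind : iIndepFun η μ) (hη1 : ∀ i ω, |η i ω| ≤ 1) (hm : ∀ i, ∫ ω, η i ω ∂μ = 0)
    {a : ℕ → Euc p} {n : ℕ} (hn : 3 ≤ n)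
    (hsum : ∀ u, ∑ i ∈ Finset.range n, (∫ ω, η i ω ^ 2 ∂μ) * ⟪a i, u⟫ ^ 2 = ‖u‖ ^ 2)
    {b : ℝ} (ha : ∀ i, ‖a i‖ ≤ b / √n) {f : Euc p → ℝ} (hL : LipschitzWith 1 f) :
    |(∫ ω, f (∑ i ∈ Finset.range n, η i ω • a i) ∂μ) - ∫ x, f x ∂(_root_.stdGaussian p)|
      ≤ (6 * swapConst * b ^ 3 + (1 + b ^ 2 + gaussMeanNorm p)) * (Real.log n / √n) := by
  have hn0 : (0 : ℝ) < n := by exact_mod_cast (by omega : 0 < n)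
  have hs : 0 < √(n : ℝ) := Real.sqrt_pos.2 hn0
  have hss : √(n : ℝ) ^ 2 = n := Real.sq_sqrt hn0.le
  have hc := swapConst_pos
  have hb : 0 ≤ b / √n := (norm_nonneg _).trans (ha 0)
  have hb0 : 0 ≤ b := by
    have := mul_nonneg hb hs.le
    rwa [div_mul_cancel₀ _ hs.ne'] at this
  have hg : 0 ≤ gaussMeanNorm p := integral_nonneg fun z => norm_nonneg z
  have h1 := abs_integral_sum_smul_sub_stdGaussian_le hη hind hη1 hm hsum hL (Nat.log 2 n + 1)
  have h2 : ∑ i ∈ Finset.range n, ‖a i‖ ^ 3 ≤ b ^ 3 / √n := by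
    calc _ ≤ ∑ i ∈ Finset.range n, (b / √n) ^ 3 :=
          Finset.sum_le_sum fun i _ => pow_le_pow_left₀ (norm_nonneg _) (ha i) 3
      _ = n * (b / √n) ^ 3 := by simp
      _ = √n ^ 2 * (b / √n) ^ 3 := by rw [hss]
      _ = _ := by field_simp
  have h3 : ∫ ω, ‖∑ i ∈ Finset.range n, η i ω • a i‖ ∂μ ≤ 1 + b ^ 2 := by
    have hsq := integral_norm_sum_smul_sq_le hη hind hη1 hm ha n
    have hi1 := integrable_norm_sum_smul_pow (μ := μ) hη hη1 a n 1
    have hi2 := integrable_norm_sum_smul_pow (μ := μ) hη hη1 a n 2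
    simp only [pow_one] at hi1
    calc _ ≤ ∫ ω, (1 + ‖∑ i ∈ Finset.range n, η i ω • a i‖ ^ 2) ∂μ := by
          refine integral_mono hi1 ((integrable_const _).add hi2) fun ω => ?_
          simp only
          nlinarith [sq_nonneg (‖∑ i ∈ Finset.range n, η i ω • a i‖ - 1),
            norm_nonneg (∑ i ∈ Finset.range n, η i ω • a i)]
      _ = 1 + ∫ ω, ‖∑ i ∈ Finset.range n, η i ω • a i‖ ^ 2 ∂μ := by
          rw [integral_add (integrable_const _) hi2]
          simp
      _ ≤ 1 + n * (b / √n) ^ 2 := by gcongr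
      _ = 1 + b ^ 2 := by rw [div_pow, hss, mul_div_cancel₀ _ hn0.ne']
  have h4 := natLog_two_add_one_le hn
  have h5 := sqrt_half_pow_natLog_le (n := n) (by omega)
  have h6 := one_le_log_of_three_le hn
  calc _ ≤ _ := h1
    _ ≤ 3 * Real.log n * (2 * swapConst * (b ^ 3 / √n))
        + 1 / √n * (1 + b ^ 2 + gaussMeanNorm p) := by gcongr
    _ ≤ 3 * Real.log n * (2 * swapConst * (b ^ 3 / √n))
        + Real.log n / √n * (1 + b ^ 2 + gaussMeanNorm p) := by gcongr
    _ = _ := by ring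

end Probability

section Responses

variable {Ω : Type*} [MeasurableSpace Ω] {μ : Measure Ω} {Y : Ω → ℝ} {q : ℝ}

lemma integral_of_bernoulli (hY : Measurable Y) (hv : ∀ ω, Y ω = 0 ∨ Y ω = 1) (hq : 0 ≤ q)
    (hprob : μ {ω | Y ω = 1} = ENNReal.ofReal q) : ∫ ω, Y ω ∂μ = q := by
  have hms : MeasurableSet {ω | Y ω = 1} := measurableSet_eq_fun hY measurable_const
  have : Y = indicator {ω | Y ω = 1} fun _ => (1 : ℝ) := by
    funext ω
    by_cases h : Y ω = 1
    · simp [h]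
    · simp [(hv ω).resolve_right h]
  calc ∫ ω, Y ω ∂μ = ∫ ω, indicator {ω | Y ω = 1} (fun _ => (1 : ℝ)) ω ∂μ := by rw [← this]
    _ = q := by
      rw [integral_indicator_const _ hms, Measure.real, hprob, ENNReal.toReal_ofReal hq]
      simp

variable [IsProbabilityMeasure μ]

lemma integrable_of_bernoulli (hY : Measurable Y) (hv : ∀ ω, Y ω = 0 ∨ Y ω = 1) :
    Integrable Y μ := by
  refine Integrable.of_bound (C := 1) hY.aestronglyMeasurable (ae_of_all _ fun ω => ?_)
  rcases hv ω with h | h <;> simp [h]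

lemma integral_sub_of_bernoulli (hY : Measurable Y) (hv : ∀ ω, Y ω = 0 ∨ Y ω = 1) (hq : 0 ≤ q)
    (hprob : μ {ω | Y ω = 1} = ENNReal.ofReal q) : ∫ ω, (Y ω - q) ∂μ = 0 := by
  rw [integral_sub (integrable_of_bernoulli hY hv) (integrable_const _),
    integral_of_bernoulli hY hv hq hprob]
  simp

lemma integral_sub_sq_of_bernoulli (hY : Measurable Y) (hv : ∀ ω, Y ω = 0 ∨ Y ω = 1) (hq : 0 ≤ q)
    (hprob : μ {ω | Y ω = 1} = ENNReal.ofReal q) : ∫ ω, (Y ω - q) ^ 2 ∂μ = q * (1 - q) := by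
  have : ∀ ω, (Y ω - q) ^ 2 = (1 - 2 * q) * Y ω + q ^ 2 := fun ω => by
    rcases hv ω with h | h <;> rw [h] <;> ring
  simp_rw [this]
  rw [integral_add ((integrable_of_bernoulli hY hv).const_mul _) (integrable_const _),
    integral_const_mul, integral_of_bernoulli hY hv hq hprob]
  simp
  ring

end Responses

lemma sum_mul_eq_inner (u v : Euc p) : ∑ j, u j * v j = ⟪u, v⟫ := by
  rw [PiLp.inner_apply]
  refine Finset.sum_congr rfl fun j _ => ?_
  simp [mul_comm]

lemma logisticScore_eq_neg_sum (x : ℕ → Euc p) (c : ℕ → ℝ) (n : ℕ) (θ : Euc p) :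
    logisticScore x c n θ
      = -∑ i ∈ Finset.range n, (c i - Real.sigmoid ⟪x i, θ⟫) • ((1 / n : ℝ) • x i) := by
  rw [logisticScore, Finset.smul_sum, ← Finset.sum_neg_distrib]
  refine Finset.sum_congr rfl fun i _ => ?_
  rw [smul_smul, smul_smul, ← neg_smul]
  congr 1
  ring

lemma sum_smul_map_eq_neg_sqrt_smul_score (L : Euc p →ₗ[ℝ] Euc p) (x : ℕ → Euc p) (c : ℕ → ℝ)
    {n : ℕ} (hn : 0 < n) (θ : Euc p) :
    ∑ i ∈ Finset.range n, (c i - Real.sigmoid ⟪x i, θ⟫) • ((1 / √n : ℝ) • L (x i))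
      = -(√(n : ℝ) • L (logisticScore x c n θ)) := by
  have hn0 : (0 : ℝ) < n := by exact_mod_cast hn
  have hs : 0 < √(n : ℝ) := Real.sqrt_pos.2 hn0
  have hss : √(n : ℝ) ^ 2 = n := Real.sq_sqrt hn0.le
  rw [logisticScore_eq_neg_sum, map_neg, smul_neg, neg_neg, map_sum, Finset.smul_sum]
  refine Finset.sum_congr rfl fun i _ => ?_
  rw [map_smul, map_smul, smul_smul, smul_smul, smul_smul]
  congr 1
  field_simp
  rw [hss]

lemma sum_sigmoid_mul_inner_sq_eq {L : Euc p →ₗ[ℝ] Euc p} (hL : L.IsSymmetric) {x : ℕ → Euc p}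
    {n : ℕ} (hn : 0 < n) {θ : Euc p} (hLH : ∀ v, L (L (logisticHess x n θ v)) = v) (u : Euc p) :
    ∑ i ∈ Finset.range n, (Real.sigmoid ⟪x i, θ⟫ * (1 - Real.sigmoid ⟪x i, θ⟫))
      * ⟪(1 / √n : ℝ) • L (x i), u⟫ ^ 2 = ‖u‖ ^ 2 := by
  have hn0 : (0 : ℝ) < n := by exact_mod_cast hn
  rw [← inner_hess_map_self hL hLH, inner_logisticHess_self, Finset.mul_sum]
  refine Finset.sum_congr rfl fun i _ => ?_
  rw [real_inner_smul_left, hL (x i) u, mul_pow, one_div_pow, Real.sq_sqrt hn0.le]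
  ring

lemma integrable_comp_of_lipschitzWith_one {Ω : Type*} [MeasurableSpace Ω] {μ : Measure Ω}
    [IsFiniteMeasure μ] {f : Euc p → ℝ} (hf : LipschitzWith 1 f) {U : Ω → Euc p}
    (hU : Measurable U) {b : ℝ} (hb : ∀ ω, ‖U ω‖ ≤ b) : Integrable (fun ω => f (U ω)) μ := by
  refine Integrable.of_bound (C := |f 0| + b)
    (hf.continuous.measurable.comp hU).aestronglyMeasurable (ae_of_all _ fun ω => ?_)
  have := hf.dist_le_mul (U ω) 0
  rw [Real.dist_eq, dist_zero_right, NNReal.coe_one, one_mul] at this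
  rw [Real.norm_eq_abs]
  calc |f (U ω)| = |f 0 + (f (U ω) - f 0)| := by ring_nf
    _ ≤ _ := (abs_add_le _ _).trans (by linarith [hb ω])

lemma continuous_logisticHess (x : ℕ → Euc p) (n : ℕ) (θ : Euc p) :
    Continuous (logisticHess x n θ) := by
  unfold logisticHess
  fun_prop

/-- The Lipschitz test function bound for the normalized maximum likelihood estimator. -/
lemma abs_integral_normalized_mle_sub_le {Ω : Type*} [MeasurableSpace Ω] {μ : Measure Ω}
    [IsProbabilityMeasure μ] {x : ℕ → Euc p} {Cx : ℝ} (hx : ∀ i, ‖x i‖ ≤ Cx) {Θ : Set (Euc p)}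
    {D : ℝ} (hD : ∀ θ ∈ Θ, ‖θ‖ ≤ D) {θ0 : Euc p} {r : ℝ} (hr : 0 < r)
    (hball : Metric.ball θ0 r ⊆ Θ) {lam : ℝ} (hlam : 0 < lam) {n : ℕ} (hn : 3 ≤ n)
    (hdes : ∀ v, lam * ‖v‖ ^ 2 ≤ (1 / n) * ∑ i ∈ Finset.range n, ⟪x i, v⟫ ^ 2)
    {y : ℕ → Ω → ℝ} (hy : ∀ i, Measurable (y i)) (hv : ∀ i ω, y i ω = 0 ∨ y i ω = 1)
    (hind : iIndepFun y μ)
    (hprob : ∀ i, μ {ω | y i ω = 1} = ENNReal.ofReal (Real.sigmoid ⟪x i, θ0⟫))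
    {θhat : Ω → Euc p} (hmeas : Measurable θhat) (hmem : ∀ ω, θhat ω ∈ Θ)
    (hmin : ∀ ω, ∀ θ ∈ Θ, logisticRisk x (fun i => y i ω) n (θhat ω)
      ≤ logisticRisk x (fun i => y i ω) n θ)
    {L : Euc p →ₗ[ℝ] Euc p} (hL : L.IsSymmetric)
    (hLH : ∀ v, L (L (logisticHess x n θ0 v)) = v) {k K B : ℝ}
    (hk : k = Real.sigmoid (-(Cx * D)) ^ 2 * lam) (hK : K = Cx ^ 3 + Cx / r ^ 2 + Cx ^ 2 / r)
    (hB : B = (√k)⁻¹) {f : Euc p → ℝ} (hf : LipschitzWith 1 f) :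
    |(∫ ω, f (√(n : ℝ) • L (logisticHess x n θ0 (θhat ω - θ0))) ∂μ)
        - ∫ z, f z ∂(_root_.stdGaussian p)|
      ≤ (B * K * (2 / k) ^ 2 * Cx ^ 2 + (6 * swapConst * (B * Cx) ^ 3
        + (1 + (B * Cx) ^ 2 + gaussMeanNorm p))) * (Real.log n / √n) := by
  have hn0 : (0 : ℝ) < n := by exact_mod_cast (by omega : 0 < n)
  have hs : 0 < √(n : ℝ) := Real.sqrt_pos.2 hn0
  have hss : √(n : ℝ) ^ 2 = n := Real.sq_sqrt hn0.le
  have hθ0 : θ0 ∈ Θ := hball (Metric.mem_ball_self hr)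
  have hCx : 0 ≤ Cx := (norm_nonneg _).trans (hx 0)
  have hk0 : 0 < k := by
    rw [hk]
    have := Real.sigmoid_pos (-(Cx * D))
    positivity
  have hB0 : 0 ≤ B := by
    rw [hB]
    positivity
  have hK0 : 0 ≤ K := by
    rw [hK]
    positivity
  set η : ℕ → Ω → ℝ := fun i ω => y i ω - Real.sigmoid ⟪x i, θ0⟫ with hηdef
  have hη : ∀ i, Measurable (η i) := fun i => (hy i).sub_const _
  have hηind : iIndepFun η μ :=
    hind.comp (fun i t => t - Real.sigmoid ⟪x i, θ0⟫) fun i => by fun_prop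
  have hη1 : ∀ i ω, |η i ω| ≤ 1 := fun i ω => by
    have h0 := Real.sigmoid_nonneg ⟪x i, θ0⟫
    have h1 := Real.sigmoid_le_one ⟪x i, θ0⟫
    rw [abs_le]
    rcases hv i ω with h | h <;> simp only [hηdef, h] <;> constructor <;> linarith
  have hηm : ∀ i, ∫ ω, η i ω ∂μ = 0 := fun i =>
    integral_sub_of_bernoulli (hy i) (hv i) (Real.sigmoid_nonneg _) (hprob i)
  have hηv : ∀ i, ∫ ω, η i ω ^ 2 ∂μ
      = Real.sigmoid ⟪x i, θ0⟫ * (1 - Real.sigmoid ⟪x i, θ0⟫) := fun i =>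
    integral_sub_sq_of_bernoulli (hy i) (hv i) (Real.sigmoid_nonneg _) (hprob i)
  have hLB : ∀ u, ‖L u‖ ≤ B * ‖u‖ := fun u => by
    rw [hB]
    refine norm_inverseSqrt_le hL hLH hk0 (fun v => ?_) u
    rw [hk]
    exact le_inner_logisticHess_self hx (hD _ hθ0) hdes v
  set a : ℕ → Euc p := fun i => (1 / √n : ℝ) • L (x i) with hadef
  have ha : ∀ i, ‖a i‖ ≤ B * Cx / √n := fun i => by
    simp only [hadef]
    rw [norm_smul, Real.norm_of_nonneg (by positivity), one_div, inv_mul_eq_div]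
    gcongr
    exact (hLB _).trans (mul_le_mul_of_nonneg_left (hx i) hB0)
  have hclt := abs_integral_sum_smul_sub_stdGaussian_le_log hη hηind hη1 hηm hn (a := a)
    (fun u => by
      simp_rw [hηv]
      exact sum_sigmoid_mul_inner_sq_eq hL (by omega) hLH u) ha hf
  set G : Ω → Euc p := fun ω => logisticScore x (fun i => y i ω) n θ0 with hGdef
  have hG : ∀ ω, G ω = -∑ i ∈ Finset.range n, η i ω • ((1 / n : ℝ) • x i) := fun ω =>
    logisticScore_eq_neg_sum x _ n θ0
  have hW : ∀ ω, ∑ i ∈ Finset.range n, η i ω • a i = -(√(n : ℝ) • L (G ω)) := fun ω =>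
    sum_smul_map_eq_neg_sqrt_smul_score L x (fun i => y i ω) (by omega) θ0
  have hGint : Integrable (fun ω => ‖G ω‖ ^ 2) μ := by
    simp_rw [hG, norm_neg]
    exact integrable_norm_sum_smul_pow hη hη1 _ n 2
  have hGsq : ∫ ω, ‖G ω‖ ^ 2 ∂μ ≤ Cx ^ 2 / n := by
    simp_rw [hG, norm_neg]
    refine (integral_norm_sum_smul_sq_le hη hηind hη1 hηm (b := Cx / n) (fun i => ?_) n).trans
      (le_of_eq (by field_simp))
    rw [norm_smul, Real.norm_of_nonneg (by positivity), one_div, inv_mul_eq_div]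
    gcongr
    exact hx i
  have hrem : ∀ ω, ‖√(n : ℝ) • L (logisticHess x n θ0 (θhat ω - θ0))
      - ∑ i ∈ Finset.range n, η i ω • a i‖ ≤ √n * (B * K * (2 / k) ^ 2) * ‖G ω‖ ^ 2 := fun ω => by
    have h1 := norm_sub_le_of_logisticRisk_le hx (hD _ (hmem ω)) (hD _ hθ0) hlam hdes
      (hmin ω θ0 hθ0)
    have h2 := norm_logisticScore_add_hess_le hx (fun i => hv i ω) hr hball (hmin ω)
    rw [← hk] at h1
    rw [← hK] at h2
    rw [hW, sub_neg_eq_add, ← smul_add, ← map_add, norm_smul, Real.norm_of_nonneg hs.le, add_comm]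
    calc _ ≤ √n * (B * (K * (2 / k * ‖G ω‖) ^ 2)) := by
          gcongr
          refine (hLB _).trans (mul_le_mul_of_nonneg_left (h2.trans ?_) hB0)
          gcongr
      _ = _ := by ring
  have hLVm : Measurable fun ω => L (logisticHess x n θ0 (θhat ω - θ0)) :=
    (L.continuous_of_finiteDimensional.measurable.comp
      (continuous_logisticHess x n θ0).measurable).comp (hmeas.sub_const θ0)
  have hVm : Measurable fun ω => √(n : ℝ) • L (logisticHess x n θ0 (θhat ω - θ0)) :=
    hLVm.fun_const_smul _
  have hVi : Integrable (fun ω => f (√(n : ℝ) • L (logisticHess x n θ0 (θhat ω - θ0)))) μ := by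
    refine integrable_comp_of_lipschitzWith_one hf hVm (b := √n * (B * (Cx ^ 2 * (D + D))))
      fun ω => ?_
    rw [norm_smul, Real.norm_of_nonneg hs.le]
    gcongr
    refine (hLB _).trans (mul_le_mul_of_nonneg_left ((norm_logisticHess_le hx _).trans ?_) hB0)
    gcongr
    exact (norm_sub_le _ _).trans (add_le_add (hD _ (hmem ω)) (hD _ hθ0))
  have hWm : Measurable fun ω => ∑ i ∈ Finset.range n, η i ω • a i :=
    Finset.measurable_sum _ fun i _ => (hη i).smul_const _
  have hWi : Integrable (fun ω => f (∑ i ∈ Finset.range n, η i ω • a i)) μ := by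
    refine integrable_comp_of_lipschitzWith_one hf hWm (b := ∑ i ∈ Finset.range n, ‖a i‖)
      fun ω => (norm_sum_le _ _).trans (Finset.sum_le_sum fun i _ => ?_)
    rw [norm_smul]
    exact mul_le_of_le_one_left (norm_nonneg _) (hη1 i ω)
  have hdiff : |(∫ ω, f (√(n : ℝ) • L (logisticHess x n θ0 (θhat ω - θ0))) ∂μ)
      - ∫ ω, f (∑ i ∈ Finset.range n, η i ω • a i) ∂μ|
      ≤ B * K * (2 / k) ^ 2 * Cx ^ 2 * (Real.log n / √n) := by
    rw [← integral_sub hVi hWi, ← Real.norm_eq_abs]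
    refine (norm_integral_le_of_norm_le (hGint.const_mul (√n * (B * K * (2 / k) ^ 2)))
      (ae_of_all _ fun ω => ?_)).trans ?_
    · have := hf.dist_le_mul (√(n : ℝ) • L (logisticHess x n θ0 (θhat ω - θ0)))
        (∑ i ∈ Finset.range n, η i ω • a i)
      rw [dist_eq_norm, dist_eq_norm, NNReal.coe_one, one_mul] at this
      exact this.trans (hrem ω)
    · rw [integral_const_mul]
      have h1 := one_le_log_of_three_le hn
      calc _ ≤ √n * (B * K * (2 / k) ^ 2) * (Cx ^ 2 / n) := by gcongr
        _ = √n * (B * K * (2 / k) ^ 2) * (Cx ^ 2 / √n ^ 2) := by rw [hss]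
        _ = B * K * (2 / k) ^ 2 * Cx ^ 2 * (1 / √n) := by field_simp
        _ ≤ _ := by gcongr
  refine (abs_sub_le _ _ _).trans ((add_le_add hdiff hclt).trans (le_of_eq ?_))
  ring

/-- The Fisher information matrix of logistic regression. -/
def logisticFisher (x : ℕ → Euc p) (n : ℕ) (θ : Euc p) : Matrix (Fin p) (Fin p) ℝ :=
  Matrix.of fun j k => (1 / n) * ∑ i ∈ Finset.range n,
    (Real.sigmoid ⟪x i, θ⟫ * (1 - Real.sigmoid ⟪x i, θ⟫)) * (x i j * x i k)

lemma toEuc_logisticFisher_mulVec (x : ℕ → Euc p) (n : ℕ) (θ v : Euc p) :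
    toEuc ((logisticFisher x n θ).mulVec v) = logisticHess x n θ v := by
  ext j
  change ∑ k : Fin p, logisticFisher x n θ j k * v k = _
  simp only [logisticFisher, logisticHess, Matrix.of_apply, PiLp.smul_apply, WithLp.ofLp_sum,
    Finset.sum_apply, smul_eq_mul]
  simp_rw [mul_assoc, ← Finset.mul_sum, Finset.sum_mul]
  rw [Finset.sum_comm]
  congr 1
  refine Finset.sum_congr rfl fun i _ => ?_
  rw [← sum_mul_eq_inner (x i) v, Finset.sum_mul, Finset.mul_sum, Finset.mul_sum]
  refine Finset.sum_congr rfl fun k _ => ?_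
  ring

lemma covariance_logisticScore {Ω : Type*} [MeasurableSpace Ω] {μ : Measure Ω}
    [IsProbabilityMeasure μ] {x : ℕ → Euc p} {θ0 : Euc p} {n : ℕ} (hn : 0 < n)
    {y : ℕ → Ω → ℝ} (hy : ∀ i, Measurable (y i)) (hv : ∀ i ω, y i ω = 0 ∨ y i ω = 1)
    (hind : iIndepFun y μ)
    (hprob : ∀ i, μ {ω | y i ω = 1} = ENNReal.ofReal (Real.sigmoid ⟪x i, θ0⟫)) (j k : Fin p) :
    (n : ℝ) * ∫ ω,
      (logisticScore x (fun i => y i ω) n θ0 j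
        - ∫ ω', logisticScore x (fun i => y i ω') n θ0 j ∂μ)
      * (logisticScore x (fun i => y i ω) n θ0 k
        - ∫ ω', logisticScore x (fun i => y i ω') n θ0 k ∂μ) ∂μ
      = logisticFisher x n θ0 j k := by
  have hn0 : (n : ℝ) ≠ 0 := by exact_mod_cast hn.ne'
  set η : ℕ → Ω → ℝ := fun i ω => y i ω - Real.sigmoid ⟪x i, θ0⟫ with hηdef
  have hη : ∀ i, Measurable (η i) := fun i => (hy i).sub_const _
  have hηind : iIndepFun η μ :=
    hind.comp (fun i t => t - Real.sigmoid ⟪x i, θ0⟫) fun i => by fun_prop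
  have hη1 : ∀ i ω, |η i ω| ≤ 1 := fun i ω => by
    have h0 := Real.sigmoid_nonneg ⟪x i, θ0⟫
    have h1 := Real.sigmoid_le_one ⟪x i, θ0⟫
    rw [abs_le]
    rcases hv i ω with h | h <;> simp only [hηdef, h] <;> constructor <;> linarith
  have hηm : ∀ i, ∫ ω, η i ω ∂μ = 0 := fun i =>
    integral_sub_of_bernoulli (hy i) (hv i) (Real.sigmoid_nonneg _) (hprob i)
  have hηv : ∀ i, ∫ ω, η i ω ^ 2 ∂μ
      = Real.sigmoid ⟪x i, θ0⟫ * (1 - Real.sigmoid ⟪x i, θ0⟫) := fun i =>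
    integral_sub_sq_of_bernoulli (hy i) (hv i) (Real.sigmoid_nonneg _) (hprob i)
  have hscore : ∀ (l : Fin p) ω, logisticScore x (fun i => y i ω) n θ0 l
      = ∑ i ∈ Finset.range n, η i ω * (-(1 / n : ℝ) * x i l) := fun l ω => by
    rw [logisticScore_eq_neg_sum]
    simp [hηdef]
  have hηi : ∀ i, Integrable (η i) μ := fun i =>
    Integrable.of_bound (C := 1) (hη i).aestronglyMeasurable (ae_of_all _ fun ω => hη1 i ω)
  have hmean : ∀ l : Fin p, ∫ ω, logisticScore x (fun i => y i ω) n θ0 l ∂μ = 0 := fun l => by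
    simp_rw [hscore]
    rw [integral_finsetSum _ fun i _ => (hηi i).mul_const _]
    refine Finset.sum_eq_zero fun i _ => ?_
    rw [integral_mul_const, hηm, zero_mul]
  simp_rw [hmean, sub_zero, hscore]
  rw [integral_sum_mul_sum_eq hη hηind hη1 hηm, logisticFisher, Matrix.of_apply, Finset.mul_sum,
    Finset.mul_sum]
  refine Finset.sum_congr rfl fun i _ => ?_
  rw [hηv]
  field_simp

lemma design_le_of_matrix_le {x : ℕ → Euc p} {n : ℕ} {lam : ℝ}
    (h : ∀ v : Fin p → ℝ, lam * (∑ j : Fin p, v j ^ 2)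
      ≤ ∑ j : Fin p, ∑ k : Fin p, v j * ((1 / n) * ∑ i ∈ Finset.range n, x i j * x i k) * v k) (v : Euc p) :
    lam * ‖v‖ ^ 2 ≤ (1 / n) * ∑ i ∈ Finset.range n, ⟪x i, v⟫ ^ 2 := by
  rw [EuclideanSpace.real_norm_sq_eq]
  refine (h v).trans (le_of_eq ?_)
  have : ∀ i, ⟪x i, v⟫ ^ 2 = ∑ j : Fin p, ∑ k : Fin p, v j * (x i j * x i k) * v k := fun i => by
    rw [← sum_mul_eq_inner, sq, Finset.sum_mul_sum]
    refine Finset.sum_congr rfl fun j _ => Finset.sum_congr rfl fun k _ => ?_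
    ring
  simp_rw [this]
  rw [Finset.sum_comm (s := Finset.range n), Finset.mul_sum]
  refine Finset.sum_congr rfl fun j _ => ?_
  rw [Finset.sum_comm (s := Finset.range n), Finset.mul_sum]
  refine Finset.sum_congr rfl fun k _ => ?_
  rw [← Finset.sum_mul, ← Finset.mul_sum]
  ring

lemma W1_map_le {Ω : Type*} [MeasurableSpace Ω] {μ : Measure Ω} {U : Ω → Euc p}
    (hU : Measurable U) {Q : Measure (Euc p)} {b : ℝ} (hb : 0 ≤ b)
    (h : ∀ f : Euc p → ℝ, LipschitzWith 1 f → |(∫ ω, f (U ω) ∂μ) - ∫ z, f z ∂Q| ≤ b) :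
    W1 (μ.map U) Q ≤ b := by
  refine Real.sSup_le ?_ hb
  rintro _ ⟨f, hf, rfl⟩
  rw [integral_map hU.aemeasurable hf.continuous.aestronglyMeasurable]
  exact h f hf

end

/-- Theorem 3: Wasserstein bound on the asymptotic normality of the maximum
likelihood estimator in logistic regression. -/
theorem logistic_regression_bound
    {p : ℕ} {Ω : Type} [MeasurableSpace Ω] (μ : Measure Ω) [IsProbabilityMeasure μ]
    (Θ : Set (Euc p)) (hΘcompact : IsCompact Θ)
    -- the deterministic covariates
    (x : ℕ → Euc p)
    -- Condition L1 (bounded covariates)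
    (Cx1 : ℝ) (hCx1 : 0 < Cx1) (hxbound : ∀ i, ‖x i‖ ≤ Cx1)
    -- Condition L2 (asymptotically positive definite design)
    (cx2 : ℝ) (Nx2 : ℕ) (hcx2 : 0 < cx2)
    (hdesign : ∀ n ≥ Nx2, ∀ v : Fin p → ℝ,
      cx2 * (∑ j, v j ^ 2)
        ≤ ∑ j, ∑ k, v j * ((1 / n) * ∑ i ∈ Finset.range n, x i j * x i k) * v k)
    -- the true parameter
    (θ0 : Euc p) (hθ0 : θ0 ∈ interior Θ)
    -- the independent binary responses with logistic success probabilities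
    (y : ℕ → Ω → ℝ)
    (hymeas : ∀ i, Measurable (y i))
    (hyvals : ∀ i ω, y i ω = 0 ∨ y i ω = 1)
    (hyindep : iIndepFun y μ)
    (hyproba : ∀ i, μ {ω | y i ω = 1}
      = ENNReal.ofReal (Real.exp (∑ j, x i j * θ0 j) / (1 + Real.exp (∑ j, x i j * θ0 j))))
    -- Condition 1 (covering)
    (CΘ c'Θ : ℝ) (hCΘ : 0 < CΘ) (hc'Θ : 0 < c'Θ)
    (hcover : ∀ ε : ℝ, 0 < ε → ε ≤ c'Θ → ∃ (N : ℕ) (pts : Fin N → Euc p),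
      (N : ℝ) ≤ CΘ / ε ^ p ∧ (∀ i, pts i ∈ Θ) ∧
      ∀ θ ∈ Θ, ∃ i, openSegment ℝ θ (pts i) ⊆ interior Θ ∧ ‖θ - pts i‖ ≤ ε)
    -- minus the normalized log-likelihood
    (M : ℕ → Ω → Euc p → ℝ)
    (hMdef : ∀ n ω θ, M n ω θ = (1 / n) * ∑ i ∈ Finset.range n,
      (-(y i ω) * (∑ j, x i j * θ j) + Real.log (1 + Real.exp (∑ j, x i j * θ j))))
    -- the maximum likelihood estimator
    (θhat : ℕ → Ω → Euc p)
    (hθhat_meas : ∀ n, Measurable (θhat n))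
    (hθhat : ∀ n ω, θhat n ω ∈ Θ ∧ ∀ θ ∈ Θ, M n ω (θhat n ω) ≤ M n ω θ)
    -- `Sinv n` is the inverse symmetric square root `C̄_{n,0}^{-1/2}`
    (Sinv : ℕ → Matrix (Fin p) (Fin p) ℝ) (N0 : ℕ)
    (hSinv : ∀ n ≥ N0, (Sinv n).PosSemidef ∧
      Sinv n * Sinv n *
        (Matrix.of fun j k => (n : ℝ) *
          ∫ ω, (pder j (M n ω) θ0 - ∫ ω', pder j (M n ω') θ0 ∂μ)
            * (pder k (M n ω) θ0 - ∫ ω', pder k (M n ω') θ0 ∂μ) ∂μ) = 1) :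
    ∃ (C₁ C₂ : ℝ) (N : ℕ), 0 < C₁ ∧ 0 < C₂ ∧ ∀ n ≥ N,
      W1 (μ.map fun ω => toEuc
            ((Sinv n * Matrix.of fun j k =>
                ∫ ω', pder k (pder j (M n ω')) θ0 ∂μ).mulVec
              fun i => Real.sqrt n * (θhat n ω i - θ0 i)))
          (stdGaussian p)
        ≤ C₁ * Real.log n ^ C₂ / Real.sqrt n := by
  obtain ⟨D, hD⟩ := hΘcompact.isBounded.exists_norm_le
  obtain ⟨r, hr, hball⟩ := Metric.mem_nhds_iff.1 (mem_interior_iff_mem_nhds.1 hθ0)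
  have hM : ∀ n ω, M n ω = logisticRisk x (fun i => y i ω) n := fun n ω => by
    funext θ
    simp only [hMdef, logisticRisk, sum_mul_eq_inner]
  have hprob : ∀ i, μ {ω | y i ω = 1}
      = ENNReal.ofReal (Real.sigmoid (inner ℝ (x i) θ0)) := fun i => by
    rw [hyproba, sum_mul_eq_inner, sigmoid_eq_exp_div]
  obtain ⟨k, hk⟩ : ∃ k, k = Real.sigmoid (-(Cx1 * D)) ^ 2 * cx2 := ⟨_, rfl⟩
  obtain ⟨K, hK⟩ : ∃ K, K = Cx1 ^ 3 + Cx1 / r ^ 2 + Cx1 ^ 2 / r := ⟨_, rfl⟩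
  obtain ⟨B, hB⟩ : ∃ B, B = (√k)⁻¹ := ⟨_, rfl⟩
  have hB0 : 0 ≤ B := by
    rw [hB]
    positivity
  have hK0 : 0 ≤ K := by
    rw [hK]
    positivity
  have hg : 0 ≤ gaussMeanNorm p := integral_nonneg fun z => norm_nonneg z
  have hsw := swapConst_pos
  have hC : 0 < B * K * (2 / k) ^ 2 * Cx1 ^ 2 + (6 * swapConst * (B * Cx1) ^ 3
      + (1 + (B * Cx1) ^ 2 + gaussMeanNorm p)) := by positivity
  refine ⟨_, 1, max 3 (max Nx2 N0), hC, one_pos, fun n hn => ?_⟩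
  have hn3 : 3 ≤ n := (le_max_left _ _).trans hn
  have hnx : Nx2 ≤ n := (le_max_left _ _).trans ((le_max_right _ _).trans hn)
  have hnS : N0 ≤ n := (le_max_right _ _).trans ((le_max_right _ _).trans hn)
  have hn0 : 0 < n := by omega
  obtain ⟨hSpsd, hS⟩ := hSinv n hnS
  have hcov : (Matrix.of fun j k => (n : ℝ) *
      ∫ ω, (pder j (M n ω) θ0 - ∫ ω', pder j (M n ω') θ0 ∂μ)
        * (pder k (M n ω) θ0 - ∫ ω', pder k (M n ω') θ0 ∂μ) ∂μ) = logisticFisher x n θ0 := by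
    ext j k
    simp only [Matrix.of_apply, hM, pder_logisticRisk]
    exact covariance_logisticScore hn0 hymeas hyvals hyindep hprob j k
  have hhess : (Matrix.of fun j k => ∫ ω', pder k (pder j (M n ω')) θ0 ∂μ)
      = logisticFisher x n θ0 := by
    ext j k
    simp [hM, pder_pder_logisticRisk, logisticFisher]
  rw [hcov] at hS
  rw [hhess, Real.rpow_one, mul_div_assoc]
  have hL : (Matrix.toEuclideanLin (Sinv n)).IsSymmetric :=
    Matrix.isSymmetric_toEuclideanLin_iff.2 hSpsd.isHermitian
  have hLapp : ∀ v : Fin p → ℝ,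
      Matrix.toEuclideanLin (Sinv n) (toEuc v) = toEuc ((Sinv n).mulVec v) := fun v => rfl
  have hLH : ∀ v, Matrix.toEuclideanLin (Sinv n)
      (Matrix.toEuclideanLin (Sinv n) (logisticHess x n θ0 v)) = v := fun v => by
    rw [← toEuc_logisticFisher_mulVec, hLapp, hLapp, Matrix.mulVec_mulVec, Matrix.mulVec_mulVec,
      hS, Matrix.one_mulVec]
    rfl
  have hU : (fun ω => toEuc ((Sinv n * logisticFisher x n θ0).mulVec
      fun i => √(n : ℝ) * (θhat n ω i - θ0 i)))
      = fun ω => √(n : ℝ) • Matrix.toEuclideanLin (Sinv n)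
        (logisticHess x n θ0 (θhat n ω - θ0)) := by
    funext ω
    rw [← toEuc_logisticFisher_mulVec, hLapp, Matrix.mulVec_mulVec]
    change toEuc ((Sinv n * logisticFisher x n θ0).mulVec
      (√(n : ℝ) • fun i => θhat n ω i - θ0 i)) = _
    rw [Matrix.mulVec_smul]
    rfl
  rw [hU]
  have hLm : Measurable fun ω => Matrix.toEuclideanLin (Sinv n)
      (logisticHess x n θ0 (θhat n ω - θ0)) :=
    ((Matrix.toEuclideanLin (Sinv n)).continuous_of_finiteDimensional.measurable.comp
      (continuous_logisticHess x n θ0).measurable).comp ((hθhat_meas n).sub_const θ0)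
  have hlog : 0 ≤ Real.log n := Real.log_natCast_nonneg n
  refine W1_map_le (hLm.fun_const_smul _) (by positivity) fun f hf => ?_
  exact abs_integral_normalized_mle_sub_le hxbound hD hr hball hcx2 hn3
    (design_le_of_matrix_le (hdesign n hnx)) hymeas hyvals hyindep hprob (hθhat_meas n)
    (fun ω => (hθhat n ω).1) (fun ω θ hθ => hM n ω ▸ (hθhat n ω).2 θ hθ) hL hLH hk hK hB hf
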